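/- For every L ≥ 2 there exists a finite constant s(L), independent of the number of particles, such that for every segment Λ ⊂ ℤ with |Λ| ≤ L, every N ≥ 1 and every f ≥ 0 on {η ∈ ℕ^Λ : Σ_x η_x = N}, Ent_{ν_Λ^N}(f) ≤ s(L) E_{ν_Λ^N}(√f, √f). -/

import Mathlib

open scoped BigOperators

noncomputable section

/-- `cfact c k = c(k)! = c(1)⋯c(k)`, with `cfact c 0 = 1`. -/
def cfact (c : ℕ → ℝ) : ℕ → ℝ
  | 0 => 1
  | k + 1 => cfact c k * c (k + 1)

/-- The configuration obtained from `η` by moving one particle from `x` to `y` (`x ≠ y`),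
i.e. `η - δ^x + δ^y`. -/
def move (η : ℤ → ℕ) (x y : ℤ) : ℤ → ℕ :=
  fun z => if z = x then η x - 1 else if z = y then η y + 1 else η z

/-- Unnormalized weight of the canonical measure `ν_Λ^N` on configurations supported in `Λ`
with `N` particles: `∏_{x∈Λ} 1/c(η_x)!`. -/
def nuW (c : ℕ → ℝ) (Λ : Finset ℤ) (N : ℕ) : (ℤ → ℕ) → ℝ :=
  Set.indicator {η : ℤ → ℕ | (∀ x, x ∉ Λ → η x = 0) ∧ (∑ x ∈ Λ, η x) = N}
    (fun η => ∏ x ∈ Λ, (cfact c (η x))⁻¹)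

/-- Expectation with respect to the probability measure obtained by normalizing the
nonnegative weight `w`. -/
def wE (w f : (ℤ → ℕ) → ℝ) : ℝ :=
  (∑' η : ℤ → ℕ, w η * f η) / (∑' η : ℤ → ℕ, w η)

/-- Covariance `μ[f,g] = μ[f g] - μ[f] μ[g]`. -/
def wCov (w f g : (ℤ → ℕ) → ℝ) : ℝ :=
  wE w (fun η => f η * g η) - wE w f * wE w g

/-- Entropy `Ent_μ(f) = μ[f log f] - μ[f] log μ[f]` (note `Real.log 0 = 0`, giving the
convention `0 log 0 = 0`). -/
def wEnt (w f : (ℤ → ℕ) → ℝ) : ℝ :=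
  wE w (fun η => f η * Real.log (f η)) - wE w f * Real.log (wE w f)

/-- Dirichlet form of the zero-range process on `Λ`:
`E(f,g) = (1/2) Σ_{x∈Λ} Σ_{y∈Λ, |x-y|=1} μ[c(η_x) ∂_{xy}f ∂_{xy}g]`. -/
def wDir (c : ℕ → ℝ) (Λ : Finset ℤ) (w f g : (ℤ → ℕ) → ℝ) : ℝ :=
  wE w (fun η => (1 / 2) * ∑ x ∈ Λ, ∑ y ∈ Λ,
    if |x - y| = 1 then c (η x) * ((f (move η x y) - f η) * (g (move η x y) - g η)) else 0)

/-- Weight conditioned on the event `∑_{x ∈ Λ₁} η x = n`. -/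
def condW (w : (ℤ → ℕ) → ℝ) (Λ₁ : Finset ℤ) (n : ℕ) : (ℤ → ℕ) → ℝ :=
  Set.indicator {η : ℤ → ℕ | (∑ x ∈ Λ₁, η x) = n} w

/-- `h(n) = (n+1)/c(n+1)`. -/
def hfun (c : ℕ → ℝ) (n : ℕ) : ℝ := (n + 1) / c (n + 1)

namespace ZR

/-- add one particle at `x` -/
def ad (η : ℤ → ℕ) (x : ℤ) : ℤ → ℕ := fun z => if z = x then η z + 1 else η z

lemma ad_self (η : ℤ → ℕ) (x : ℤ) : ad η x x = η x + 1 := by simp [ad]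

lemma ad_ne (η : ℤ → ℕ) {x z : ℤ} (h : z ≠ x) : ad η x z = η z := by simp [ad, h]

lemma ad_comm (η : ℤ → ℕ) (x y : ℤ) : ad (ad η x) y = ad (ad η y) x := by
  funext z; simp only [ad]; split_ifs <;> rfl

lemma ad_inj (x : ℤ) : Function.Injective (fun η => ad η x) := by
  intro a b h
  funext z
  have := congrFun h z
  simp only [ad] at this
  split_ifs at this <;> omega

/-- remove one particle at `x` -/
def rm (η : ℤ → ℕ) (x : ℤ) : ℤ → ℕ := fun z => if z = x then η z - 1 else η z

lemma rm_ad (η : ℤ → ℕ) (x : ℤ) : rm (ad η x) x = η := by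
  funext z; simp only [ad, rm]; split_ifs <;> simp

lemma ad_rm (η : ℤ → ℕ) (x : ℤ) (h : η x ≠ 0) : ad (rm η x) x = η := by
  funext z; simp only [ad, rm]; split_ifs with hz
  · subst hz; omega
  · rfl

/-- configurations -/
def S (Λ : Finset ℤ) (N : ℕ) : Finset (ℤ → ℕ) := Finset.piAntidiag Λ N

lemma mem_S {Λ : Finset ℤ} {N : ℕ} {η : ℤ → ℕ} :
    η ∈ S Λ N ↔ (∑ x ∈ Λ, η x) = N ∧ ∀ x, η x ≠ 0 → x ∈ Λ := by
  simp [S, Finset.mem_piAntidiag]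

lemma sum_ad {Λ : Finset ℤ} {x : ℤ} (hx : x ∈ Λ) (η : ℤ → ℕ) :
    ∑ z ∈ Λ, ad η x z = ∑ z ∈ Λ, η z + 1 := by
  have : ∀ z, ad η x z = η z + if z = x then 1 else 0 := by
    intro z; simp only [ad]; split_ifs <;> simp
  simp [this, Finset.sum_add_distrib, hx]

lemma ad_mem {Λ : Finset ℤ} {N : ℕ} {x : ℤ} (hx : x ∈ Λ) {η : ℤ → ℕ} (h : η ∈ S Λ N) :
    ad η x ∈ S Λ (N + 1) := by
  rw [mem_S] at *
  refine ⟨by rw [sum_ad hx, h.1], fun z hz => ?_⟩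
  by_cases hzx : z = x
  · rwa [hzx]
  · rw [ad_ne _ hzx] at hz; exact h.2 z hz

lemma rm_mem {Λ : Finset ℤ} {N : ℕ} {x : ℤ} (hx : x ∈ Λ) {η : ℤ → ℕ} (h : η ∈ S Λ (N + 1))
    (h0 : η x ≠ 0) : rm η x ∈ S Λ N := by
  rw [mem_S] at *
  have h1 := sum_ad hx (rm η x)
  rw [ad_rm _ _ h0] at h1
  refine ⟨by omega, fun z hz => h.2 z ?_⟩
  intro h3; apply hz; simp [rm, h3]

lemma le_of_mem {Λ : Finset ℤ} {N : ℕ} {x : ℤ} (hx : x ∈ Λ) {η : ℤ → ℕ} (h : η ∈ S Λ N) :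
    η x ≤ N := by
  rw [mem_S] at h
  rw [← h.1]
  exact Finset.single_le_sum (f := η) (fun _ _ => Nat.zero_le _) hx

/-- the weight -/
def wt (c : ℕ → ℝ) (Λ : Finset ℤ) (η : ℤ → ℕ) : ℝ := ∏ x ∈ Λ, (cfact c (η x))⁻¹

lemma cfact_pos {c : ℕ → ℝ} (hc : ∀ n : ℕ, 0 < n → 0 < c n) (n : ℕ) : 0 < cfact c n := by
  induction n with
  | zero => simp [cfact]
  | succ k ih => exact mul_pos ih (hc _ (Nat.succ_pos _))

lemma wt_pos {c : ℕ → ℝ} (hc : ∀ n : ℕ, 0 < n → 0 < c n) (Λ : Finset ℤ) (η : ℤ → ℕ) :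
    0 < wt c Λ η :=
  Finset.prod_pos fun _ _ => inv_pos.2 (cfact_pos hc _)

lemma wt_ad {c : ℕ → ℝ} (hc : ∀ n : ℕ, 0 < n → 0 < c n) {Λ : Finset ℤ} {x : ℤ} (hx : x ∈ Λ)
    (η : ℤ → ℕ) : wt c Λ (ad η x) * c (ad η x x) = wt c Λ η := by
  unfold wt
  rw [← Finset.mul_prod_erase Λ _ hx, ← Finset.mul_prod_erase Λ (fun z => (cfact c (η z))⁻¹) hx]
  have : ∏ z ∈ Λ.erase x, (cfact c (ad η x z))⁻¹ = ∏ z ∈ Λ.erase x, (cfact c (η z))⁻¹ := by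
    apply Finset.prod_congr rfl
    intro z hz
    rw [ad_ne _ (Finset.ne_of_mem_erase hz)]
  rw [this, ad_self]
  have h1 := (cfact_pos hc (η x)).ne'
  have h2 := (hc (η x + 1) (Nat.succ_pos _)).ne'
  simp only [cfact]
  field_simp

/-- integration by parts -/
lemma ibp {c : ℕ → ℝ} (hc0 : c 0 = 0) (hc : ∀ n : ℕ, 0 < n → 0 < c n) {Λ : Finset ℤ} {x : ℤ}
    (hx : x ∈ Λ) (N : ℕ) (F : (ℤ → ℕ) → ℝ) :
    ∑ η ∈ S Λ (N + 1), wt c Λ η * (c (η x) * F η) = ∑ ξ ∈ S Λ N, wt c Λ ξ * F (ad ξ x) := by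
  classical
  have h1 : ∑ ξ ∈ S Λ N, wt c Λ ξ * F (ad ξ x)
      = ∑ η ∈ (S Λ N).image (fun ξ => ad ξ x), wt c Λ η * (c (η x) * F η) := by
    rw [Finset.sum_image (fun a _ b _ h => ad_inj x h)]
    apply Finset.sum_congr rfl
    intro ξ _
    rw [← wt_ad hc hx ξ]; ring
  rw [h1]
  symm
  apply Finset.sum_subset
  · intro η hη
    rw [Finset.mem_image] at hη
    obtain ⟨ξ, hξ, rfl⟩ := hη
    exact ad_mem hx hξ
  · intro η hη hn
    by_cases h0 : η x = 0
    · simp [h0, hc0]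
    · exfalso; apply hn
      rw [Finset.mem_image]
      exact ⟨rm η x, rm_mem hx hη h0, ad_rm _ _ h0⟩

/-- Dirichlet form on the complete graph, for `M+1` particles. -/
def DF (c : ℕ → ℝ) (Λ : Finset ℤ) (M : ℕ) (g : (ℤ → ℕ) → ℝ) : ℝ :=
  ∑ ξ ∈ S Λ M, wt c Λ ξ * ∑ x ∈ Λ, ∑ y ∈ Λ, (g (ad ξ y) - g (ad ξ x)) ^ 2

lemma DF_nonneg {c : ℕ → ℝ} (hc : ∀ n : ℕ, 0 < n → 0 < c n) (Λ : Finset ℤ) (M : ℕ)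
    (g : (ℤ → ℕ) → ℝ) : 0 ≤ DF c Λ M g :=
  Finset.sum_nonneg fun ξ _ => mul_nonneg (wt_pos hc Λ ξ).le
    (Finset.sum_nonneg fun _ _ => Finset.sum_nonneg fun _ _ => sq_nonneg _)

lemma S_nonempty {Λ : Finset ℤ} (hΛ : Λ.Nonempty) (N : ℕ) : (S Λ N).Nonempty := by
  obtain ⟨x, hx⟩ := hΛ
  induction N with
  | zero => exact ⟨fun _ => 0, by simp [mem_S]⟩
  | succ n ih => obtain ⟨η, h⟩ := ih; exact ⟨_, ad_mem hx h⟩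

lemma Z_pos {c : ℕ → ℝ} (hc : ∀ n : ℕ, 0 < n → 0 < c n) {Λ : Finset ℤ} (hΛ : Λ.Nonempty) (N : ℕ) :
    0 < ∑ η ∈ S Λ N, wt c Λ η :=
  Finset.sum_pos (fun _ _ => wt_pos hc _ _) (S_nonempty hΛ N)

/-- unnormalised entropy -/
def uent {α : Type*} (s : Finset α) (w f : α → ℝ) : ℝ :=
  ∑ a ∈ s, w a * (f a * Real.log (f a)) -
    (∑ a ∈ s, w a * f a) * Real.log ((∑ a ∈ s, w a * f a) / ∑ a ∈ s, w a)

/-- `x log (x/y) ≥ x - y` -/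
lemma xlog_ge {x y : ℝ} (hx : 0 ≤ x) (hy : 0 ≤ y) (h : y = 0 → x = 0) :
    x - y ≤ x * (Real.log x - Real.log y) := by
  rcases hx.eq_or_lt with rfl | hx
  · simpa using hy
  have hy' : 0 < y := lt_of_le_of_ne hy (fun h0 => hx.ne' (h h0.symm))
  have := Real.log_le_sub_one_of_pos (div_pos hy' hx)
  rw [Real.log_div hy'.ne' hx.ne'] at this
  have h2 := mul_le_mul_of_nonneg_left this hx.le
  have : x * (y / x - 1) = y - x := by field_simp
  nlinarith

lemma uent_le {α : Type*} (s : Finset α) (w f : α → ℝ) (hw : ∀ a ∈ s, 0 ≤ w a)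
    (hf : ∀ a ∈ s, 0 ≤ f a) (hZ : 0 < ∑ a ∈ s, w a) {t : ℝ} (ht : 0 < t) :
    uent s w f ≤ ∑ a ∈ s, w a * (f a * (Real.log (f a) - Real.log t) - f a + t) := by
  have hA : 0 ≤ ∑ a ∈ s, w a * f a := Finset.sum_nonneg fun a ha => mul_nonneg (hw a ha) (hf a ha)
  have e : ∑ a ∈ s, w a * (f a * (Real.log (f a) - Real.log t) - f a + t)
      = ∑ a ∈ s, w a * (f a * Real.log (f a)) - (∑ a ∈ s, w a * f a) * Real.log t
        - ∑ a ∈ s, w a * f a + (∑ a ∈ s, w a) * t := by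
    rw [Finset.sum_mul, Finset.sum_mul, ← Finset.sum_sub_distrib, ← Finset.sum_sub_distrib,
      ← Finset.sum_add_distrib]
    exact Finset.sum_congr rfl fun a _ => by ring
  rw [e, uent]
  set A := ∑ a ∈ s, w a * f a
  set Z := ∑ a ∈ s, w a
  rcases hA.eq_or_lt with h0 | h0
  · rw [← h0]; simp; positivity
  · have := xlog_ge hA (mul_pos hZ ht).le (fun h => absurd h (mul_pos hZ ht).ne')
    rw [Real.log_mul hZ.ne' ht.ne'] at this
    rw [Real.log_div h0.ne' hZ.ne']
    nlinarith

lemma gibbs {α : Type*} (s : Finset α) (w f h : α → ℝ) (hw : ∀ a ∈ s, 0 ≤ w a)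
    (hf : ∀ a ∈ s, 0 ≤ f a) (hh : ∀ a ∈ s, 0 ≤ h a) (hfh : ∀ a ∈ s, h a = 0 → f a = 0)
    (hZ : 0 < ∑ a ∈ s, w a) :
    ∑ a ∈ s, w a * (f a * Real.log (h a)) -
      (∑ a ∈ s, w a * f a) * Real.log ((∑ a ∈ s, w a * h a) / ∑ a ∈ s, w a) ≤ uent s w f := by
  unfold uent
  have hA : 0 ≤ ∑ a ∈ s, w a * f a := Finset.sum_nonneg fun a ha => mul_nonneg (hw a ha) (hf a ha)
  have hB : 0 ≤ ∑ a ∈ s, w a * h a := Finset.sum_nonneg fun a ha => mul_nonneg (hw a ha) (hh a ha)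
  have hz : (∑ a ∈ s, w a * h a) = 0 → (∑ a ∈ s, w a * f a) = 0 := by
    intro h0
    rw [Finset.sum_eq_zero_iff_of_nonneg (fun a ha => mul_nonneg (hw a ha) (hh a ha))] at h0
    apply Finset.sum_eq_zero
    intro a ha
    rcases mul_eq_zero.1 (h0 a ha) with h1 | h1
    · simp [h1]
    · simp [hfh a ha h1]
  rcases hA.eq_or_lt with h0 | h0
  · have h1 := h0.symm
    rw [Finset.sum_eq_zero_iff_of_nonneg (fun a ha => mul_nonneg (hw a ha) (hf a ha))] at h1
    have : ∀ F : α → ℝ, ∑ a ∈ s, w a * (f a * F a) = 0 := by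
      intro F
      apply Finset.sum_eq_zero
      intro a ha
      rw [← mul_assoc, h1 a ha, zero_mul]
    rw [this, ← h0, this]; simp
  · have hB' : 0 < ∑ a ∈ s, w a * h a := lt_of_le_of_ne hB (fun hh => h0.ne' (hz hh.symm))
    set A := ∑ a ∈ s, w a * f a with hAd
    set B := ∑ a ∈ s, w a * h a with hBd
    set Z := ∑ a ∈ s, w a
    have key : ∀ a ∈ s, w a * (f a - h a * (A / B)) ≤
        w a * (f a * Real.log (f a)) - w a * (f a * Real.log (h a))
          - w a * f a * Real.log (A / B) := by
      intro a ha
      have := xlog_ge (x := f a) (y := h a * (A / B)) (hf a ha)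
        (mul_nonneg (hh a ha) (by positivity)) (fun h1 => by
          rcases mul_eq_zero.1 h1 with h2 | h2
          · exact hfh a ha h2
          · exact absurd h2 (by positivity))
      have h3 : f a * Real.log (h a * (A / B)) = f a * (Real.log (h a) + Real.log (A / B)) := by
        by_cases h4 : h a = 0
        · simp [hfh a ha h4]
        · rw [Real.log_mul h4 (by positivity)]
      have := mul_le_mul_of_nonneg_left this (hw a ha)
      rw [mul_sub (f a), h3] at this
      linarith
    have := Finset.sum_le_sum key
    rw [Finset.sum_sub_distrib, Finset.sum_sub_distrib, ← Finset.sum_mul, ← hAd] at this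
    have e : ∑ a ∈ s, w a * (f a - h a * (A / B)) = A - B * (A / B) := by
      rw [hAd, hBd, Finset.sum_mul, ← Finset.sum_sub_distrib]
      exact Finset.sum_congr rfl fun a _ => by ring
    have e2 : B * (A / B) = A := by field_simp
    have hZ' := hZ.ne'
    rw [e, e2, Real.log_div h0.ne' hB'.ne'] at this
    rw [Real.log_div h0.ne' hZ.ne', Real.log_div hB'.ne' hZ.ne']
    linarith

end ZR

namespace ZR

/-- pointwise form of the centering inequality -/
lemma center_pt {g a s : ℝ} (hs : 0 < s) :
    g ^ 2 * (Real.log (g ^ 2) - Real.log (a ^ 2 + s)) - g ^ 2 + (a ^ 2 + s) ≤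
      15 * ((g - a) ^ 2 * max 0 (Real.log ((g - a) ^ 2 / s)) + (g - a) ^ 2 + s) := by
  have ht : 0 < a ^ 2 + s := by positivity
  have hx : 0 ≤ g ^ 2 := sq_nonneg g
  have hm : 0 ≤ (g - a) ^ 2 * max 0 (Real.log ((g - a) ^ 2 / s)) :=
    mul_nonneg (sq_nonneg _) (le_max_left _ _)
  rcases le_total ((g - a) ^ 2) (a ^ 2 + s) with h | h
  · -- x log (x/t) - x + t ≤ (x-t)^2/t
    have h1 : g ^ 2 * (Real.log (g ^ 2) - Real.log (a ^ 2 + s)) - g ^ 2 + (a ^ 2 + s) ≤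
        (g ^ 2 - (a ^ 2 + s)) ^ 2 / (a ^ 2 + s) := by
      rcases hx.eq_or_lt with h0 | h0
      · rw [← h0]; simp only [zero_mul, zero_sub, neg_zero]
        rw [le_div_iff₀ ht]; nlinarith
      · have := Real.log_le_sub_one_of_pos (div_pos h0 ht)
        rw [Real.log_div h0.ne' ht.ne'] at this
        have h2 := mul_le_mul_of_nonneg_left this hx
        have h3 : g ^ 2 * (g ^ 2 / (a ^ 2 + s) - 1) - g ^ 2 + (a ^ 2 + s) =
          (g ^ 2 - (a ^ 2 + s)) ^ 2 / (a ^ 2 + s) := by field_simp; ring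
        linarith
    have h2 : (g ^ 2 - (a ^ 2 + s)) ^ 2 / (a ^ 2 + s) ≤ 15 * ((g - a) ^ 2 + s) := by
      rw [div_le_iff₀ ht]
      set u := g - a with hu
      have hg' : g = u + a := by rw [hu]; ring
      rw [hg']
      have e : (u + a) ^ 2 - (a ^ 2 + s) = 2 * a * u + u ^ 2 - s := by ring
      rw [e]
      have h4 : (2 * a * u + u ^ 2 - s) ^ 2 ≤ 3 * (4 * a ^ 2 * u ^ 2 + u ^ 2 * u ^ 2 + s ^ 2) := by
        nlinarith [sq_nonneg (2 * a * u - u ^ 2), sq_nonneg (2 * a * u + s), sq_nonneg (u ^ 2 + s)]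
      have h5 : u ^ 2 * u ^ 2 ≤ u ^ 2 * (a ^ 2 + s) := mul_le_mul_of_nonneg_left h (sq_nonneg _)
      have h6 : 0 ≤ u ^ 2 * s := by positivity
      have h7 : 0 ≤ s * a ^ 2 := by positivity
      nlinarith
    linarith
  · have hu0 : 0 < (g - a) ^ 2 := lt_of_lt_of_le ht h
    have hx4 : g ^ 2 ≤ 4 * (g - a) ^ 2 := by
      nlinarith [sq_nonneg (g - 2 * a)]
    have h1 : g ^ 2 * (Real.log (g ^ 2) - Real.log (a ^ 2 + s)) ≤
        4 * (g - a) ^ 2 * (2 + max 0 (Real.log ((g - a) ^ 2 / s))) := by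
      rcases le_total (g ^ 2) (a ^ 2 + s) with h2 | h2
      · have : g ^ 2 * (Real.log (g ^ 2) - Real.log (a ^ 2 + s)) ≤ 0 := by
          rcases hx.eq_or_lt with h0 | h0
          · rw [← h0]; simp
          · exact mul_nonpos_of_nonneg_of_nonpos hx (sub_nonpos.2 (Real.log_le_log h0 h2))
        have h3 : 0 ≤ 4 * (g - a) ^ 2 * (2 + max 0 (Real.log ((g - a) ^ 2 / s))) := by
          have := le_max_left 0 (Real.log ((g - a) ^ 2 / s))
          positivity
        linarith
      · have h0 : 0 < g ^ 2 := lt_of_lt_of_le ht h2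
        have l1 : 0 ≤ Real.log (g ^ 2) - Real.log (a ^ 2 + s) := sub_nonneg.2 (Real.log_le_log ht h2)
        have l2 : Real.log (g ^ 2) ≤ Real.log (4 * (g - a) ^ 2) := Real.log_le_log h0 hx4
        rw [Real.log_mul (by norm_num) hu0.ne'] at l2
        have l3 : Real.log s ≤ Real.log (a ^ 2 + s) := Real.log_le_log hs (by nlinarith [sq_nonneg a])
        have l4 : Real.log 4 ≤ 2 := by
          have : (4:ℝ) = 2 ^ 2 := by norm_num
          rw [this, Real.log_pow]; push_cast
          linarith [Real.log_two_lt_d9]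
        have l5 := le_max_right 0 (Real.log ((g - a) ^ 2 / s))
        rw [Real.log_div hu0.ne' hs.ne'] at l5 ⊢
        exact mul_le_mul hx4 (by linarith) l1 (by positivity)
    nlinarith

lemma ylogy {y : ℝ} (hy : 0 ≤ y) : y * max 0 (Real.log y) ≤ y * Real.log y + 1 := by
  rcases le_total 0 (Real.log y) with h | h
  · rw [max_eq_right h]; linarith
  · rw [max_eq_left h]
    have := xlog_ge hy zero_le_one (fun h => absurd h one_ne_zero)
    simp at this; linarith

/-- centering (Rothaus type) -/
lemma center {α : Type*} (s : Finset α) (w g : α → ℝ) (hw : ∀ a ∈ s, 0 ≤ w a)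
    (hZ : 0 < ∑ a ∈ s, w a) (b : ℝ) :
    uent s w (fun a => g a ^ 2) ≤ 15 * (uent s w (fun a => (g a - b) ^ 2)
      + 3 * ∑ a ∈ s, w a * (g a - b) ^ 2) := by
  set X := ∑ a ∈ s, w a * (g a - b) ^ 2 with hX
  set Z := ∑ a ∈ s, w a with hZd
  have hX0 : 0 ≤ X := Finset.sum_nonneg fun a ha => mul_nonneg (hw a ha) (sq_nonneg _)
  rcases hX0.eq_or_lt with h0 | h0
  · have h1 := h0.symm
    rw [hX, Finset.sum_eq_zero_iff_of_nonneg (fun a ha => mul_nonneg (hw a ha) (sq_nonneg _))] at h1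
    have h2 : ∀ F : ℝ → ℝ, ∑ a ∈ s, w a * F (g a) = Z * F b := by
      intro F
      rw [hZd, Finset.sum_mul]
      apply Finset.sum_congr rfl
      intro a ha
      rcases mul_eq_zero.1 (h1 a ha) with h3 | h3
      · simp [h3]
      · rw [sub_eq_zero.1 (pow_eq_zero_iff two_ne_zero |>.1 h3)]
    have e1 : uent s w (fun a => g a ^ 2) = 0 := by
      unfold uent
      rw [h2 (fun t => t ^ 2 * Real.log (t ^ 2)), h2 (fun t => t ^ 2), ← hZd,
        mul_div_cancel_left₀ _ hZ.ne']
      ring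
    have e2 : uent s w (fun a => (g a - b) ^ 2) = 0 := by
      unfold uent
      rw [h2 (fun t => (t - b) ^ 2 * Real.log ((t - b) ^ 2)), h2 (fun t => (t - b) ^ 2)]
      simp
    rw [e1, e2, ← h0]; simp
  · set q := X / Z with hq
    have hq0 : 0 < q := div_pos h0 hZ
    have h1 := uent_le s w (fun a => g a ^ 2) hw (fun a _ => sq_nonneg _) hZ
      (t := b ^ 2 + q) (by positivity)
    have h2 : ∀ a ∈ s, w a * (g a ^ 2 * (Real.log (g a ^ 2) - Real.log (b ^ 2 + q)) - g a ^ 2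
        + (b ^ 2 + q)) ≤ w a * (15 * ((g a - b) ^ 2 * (Real.log ((g a - b) ^ 2) - Real.log q)
          + (g a - b) ^ 2 + 2 * q)) := by
      intro a ha
      apply mul_le_mul_of_nonneg_left _ (hw a ha)
      refine (center_pt hq0).trans ?_
      have := ylogy (y := (g a - b) ^ 2 / q) (by positivity)
      have h3 := mul_le_mul_of_nonneg_left this hq0.le
      have e1 : q * ((g a - b) ^ 2 / q * max 0 (Real.log ((g a - b) ^ 2 / q))) =
        (g a - b) ^ 2 * max 0 (Real.log ((g a - b) ^ 2 / q)) := by field_simp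
      have e2 : q * ((g a - b) ^ 2 / q * Real.log ((g a - b) ^ 2 / q) + 1) =
        (g a - b) ^ 2 * (Real.log ((g a - b) ^ 2) - Real.log q) + q := by
        by_cases h5 : (g a - b) ^ 2 = 0
        · simp [h5]
        · rw [Real.log_div h5 hq0.ne']; field_simp
      rw [e1, e2] at h3
      linarith
    refine h1.trans ((Finset.sum_le_sum h2).trans (le_of_eq ?_))
    have e : ∑ a ∈ s, w a * (15 * ((g a - b) ^ 2 * (Real.log ((g a - b) ^ 2) - Real.log q)
          + (g a - b) ^ 2 + 2 * q)) = 15 * (∑ a ∈ s, w a * ((g a - b) ^ 2 *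
          Real.log ((g a - b) ^ 2)) - X * Real.log q + X + 2 * (Z * q)) := by
      rw [hX, hZd, Finset.sum_mul, Finset.sum_mul, Finset.mul_sum (s := s) (a := (2:ℝ)),
        ← Finset.sum_sub_distrib,
        ← Finset.sum_add_distrib, ← Finset.sum_add_distrib, Finset.mul_sum]
      exact Finset.sum_congr rfl fun a _ => by ring
    have e2 : Z * q = X := by rw [hq]; field_simp
    rw [e, e2, uent, ← hX, ← hZd, ← hq]; ring

/-- one particle -/
lemma lsi_one (Λ : Finset ℤ) (hΛ : Λ.Nonempty) (g : ℤ → ℝ) :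
    uent Λ (fun _ => 1) (fun x => g x ^ 2) ≤
      15 * ((Λ.card : ℝ) + 3) * ∑ x ∈ Λ, ∑ y ∈ Λ, (g y - g x) ^ 2 := by
  obtain ⟨z, hz⟩ := hΛ
  have hK : (0:ℝ) < Λ.card := by exact_mod_cast Finset.card_pos.2 ⟨z, hz⟩
  have h1 := center Λ (fun _ => 1) g (fun _ _ => zero_le_one)
    (by simpa using (Finset.card_pos.2 ⟨z, hz⟩)) (g z)
  refine h1.trans ?_
  set X := ∑ x ∈ Λ, (1:ℝ) * (g x - g z) ^ 2 with hX
  have hX0 : 0 ≤ X := Finset.sum_nonneg fun a ha => by positivity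
  have h2 : uent Λ (fun _ => 1) (fun x => (g x - g z) ^ 2) ≤ Λ.card * X := by
    unfold uent
    rw [← hX]
    simp only [Finset.sum_const, nsmul_eq_mul, mul_one, one_mul]
    rcases hX0.eq_or_lt with h0 | h0
    · rw [← h0]
      have h3 := h0.symm
      rw [hX, Finset.sum_eq_zero_iff_of_nonneg (fun a ha => by positivity)] at h3
      simp only [one_mul] at h3
      rw [Finset.sum_eq_zero (fun x hx => by rw [h3 x hx]; simp)]
      simp
    · have h4 : ∑ x ∈ Λ, (g x - g z) ^ 2 * Real.log ((g x - g z) ^ 2) ≤ X * Real.log X := by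
        rw [hX, Finset.sum_mul, ← hX]
        apply Finset.sum_le_sum
        intro x hx
        rw [one_mul]
        rcases (sq_nonneg (g x - g z)).eq_or_lt with h5 | h5
        · rw [← h5]; simp
        · apply mul_le_mul_of_nonneg_left _ h5.le
          apply Real.log_le_log h5
          have := Finset.single_le_sum (f := fun x => (1:ℝ) * (g x - g z) ^ 2)
            (fun i _ => by positivity) hx
          rw [← hX] at this
          simpa only [one_mul] using this
      rw [Real.log_div h0.ne' hK.ne']
      have h6 := Real.log_le_sub_one_of_pos hK
      nlinarith
  have h3 : X ≤ ∑ x ∈ Λ, ∑ y ∈ Λ, (g y - g x) ^ 2 := by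
    have := Finset.single_le_sum (f := fun x => ∑ y ∈ Λ, (g y - g x) ^ 2)
            (fun i _ => Finset.sum_nonneg fun _ _ => sq_nonneg _) hz
    simpa [hX] using this
  have : (Λ.card + 3) * X ≤ (Λ.card + 3) * ∑ x ∈ Λ, ∑ y ∈ Λ, (g y - g x) ^ 2 :=
    mul_le_mul_of_nonneg_left h3 (by positivity)
  nlinarith

/-- tensorization -/
lemma tensor {α : Type*} (s : Finset α) (w : α → ℝ) (Λ : Finset ℤ) (hΛ : Λ.Nonempty)
    (F : α → ℤ → ℝ) (hw : ∀ a ∈ s, 0 ≤ w a) (hF : ∀ a x, 0 ≤ F a x) (hZ : 0 < ∑ a ∈ s, w a) :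
    ∑ x ∈ Λ, ∑ a ∈ s, w a * (F a x * Real.log (F a x)) -
      (∑ x ∈ Λ, ∑ a ∈ s, w a * F a x) *
        Real.log ((∑ x ∈ Λ, ∑ a ∈ s, w a * F a x) / (Λ.card * ∑ a ∈ s, w a)) ≤
    ∑ a ∈ s, w a * uent Λ (fun _ => 1) (F a) + ∑ x ∈ Λ, uent s w (fun a => F a x) := by
  set K : ℝ := (Λ.card : ℝ) with hKd
  have hK : 0 < K := by rw [hKd]; exact_mod_cast Finset.card_pos.2 hΛ
  set Z := ∑ a ∈ s, w a with hZd
  set H : α → ℝ := fun a => (∑ x ∈ Λ, F a x) / K with hH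
  have hA : ∑ a ∈ s, w a * H a = (∑ x ∈ Λ, ∑ a ∈ s, w a * F a x) / K := by
    rw [Finset.sum_comm, Finset.sum_div]
    apply Finset.sum_congr rfl
    intro a _
    rw [hH]; simp only; rw [mul_div_assoc', Finset.mul_sum]
  set A := ∑ x ∈ Λ, ∑ a ∈ s, w a * F a x with hAd
  have g1 : ∀ x ∈ Λ, ∑ a ∈ s, w a * (F a x * Real.log (H a)) -
      (∑ a ∈ s, w a * F a x) * Real.log (A / (K * Z)) ≤ uent s w (fun a => F a x) := by
    intro x hx
    have := gibbs s w (fun a => F a x) H hw (fun a _ => hF a x)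
      (fun a _ => div_nonneg (Finset.sum_nonneg fun _ _ => hF _ _) hK.le) (by
        intro a _ h0
        rw [hH] at h0
        simp only [div_eq_zero_iff, hK.ne', or_false] at h0
        rw [Finset.sum_eq_zero_iff_of_nonneg (fun _ _ => hF _ _)] at h0
        exact h0 x hx) hZ
    rwa [hA, ← hZd, div_div] at this
  have g2 := Finset.sum_le_sum g1
  rw [Finset.sum_sub_distrib, ← Finset.sum_mul, ← hAd] at g2
  have g3 : ∑ a ∈ s, w a * uent Λ (fun _ => 1) (F a) =
      ∑ x ∈ Λ, ∑ a ∈ s, w a * (F a x * Real.log (F a x)) -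
      ∑ x ∈ Λ, ∑ a ∈ s, w a * (F a x * Real.log (H a)) := by
    rw [Finset.sum_comm, Finset.sum_comm (s := Λ), ← Finset.sum_sub_distrib]
    apply Finset.sum_congr rfl
    intro a _
    rw [← Finset.mul_sum, ← Finset.mul_sum, ← mul_sub]
    congr 1
    simp only [uent, one_mul, Finset.sum_const, nsmul_eq_mul, mul_one, ← hKd, ← Finset.sum_mul, hH]
  linarith

lemma idpos : ∀ n : ℕ, 0 < n → 0 < (n : ℝ) := fun n hn => by exact_mod_cast hn

/-- the reference rate -/
def cid : ℕ → ℝ := fun n => (n : ℝ)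

lemma cid0 : cid 0 = 0 := by simp [cid]
lemma cidpos : ∀ n : ℕ, 0 < n → 0 < cid n := idpos

lemma step_sum (Λ : Finset ℤ) (N : ℕ) (F : (ℤ → ℕ) → ℝ) :
    ((N : ℝ) + 1) * ∑ η ∈ S Λ (N + 1), wt cid Λ η * F η =
      ∑ x ∈ Λ, ∑ ξ ∈ S Λ N, wt cid Λ ξ * F (ad ξ x) := by
  have : ∑ x ∈ Λ, ∑ ξ ∈ S Λ N, wt cid Λ ξ * F (ad ξ x) =
      ∑ x ∈ Λ, ∑ η ∈ S Λ (N + 1), wt cid Λ η * (cid (η x) * F η) :=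
    Finset.sum_congr rfl fun x hx => (ibp cid0 cidpos hx N F).symm
  rw [this, Finset.sum_comm, Finset.mul_sum]
  apply Finset.sum_congr rfl
  intro η hη
  rw [← Finset.mul_sum, ← Finset.sum_mul]
  have : ∑ x ∈ Λ, cid (η x) = (N : ℝ) + 1 := by
    have := (mem_S.1 hη).1
    simp only [cid]; exact_mod_cast this
  rw [this]; ring

/-- LSI for the multinomial measure -/
lemma lsi_multi (Λ : Finset ℤ) (hΛ : Λ.Nonempty) (M : ℕ) (g : (ℤ → ℕ) → ℝ) :
    uent (S Λ (M + 1)) (wt cid Λ) (fun η => g η ^ 2) ≤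
      15 * ((Λ.card : ℝ) + 3) * DF cid Λ M g := by
  -- general step
  have stp : ∀ (N : ℕ) (g : (ℤ → ℕ) → ℝ),
      ((N : ℝ) + 1) * uent (S Λ (N + 1)) (wt cid Λ) (fun η => g η ^ 2) ≤
      15 * ((Λ.card : ℝ) + 3) * DF cid Λ N g +
        ∑ x ∈ Λ, uent (S Λ N) (wt cid Λ) (fun ξ => g (ad ξ x) ^ 2) := by
    intro N g
    have t := tensor (S Λ N) (wt cid Λ) Λ hΛ (fun ξ x => g (ad ξ x) ^ 2)
      (fun _ _ => (wt_pos cidpos _ _).le) (fun _ _ => sq_nonneg _) (Z_pos cidpos hΛ N)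
    have hN : (0:ℝ) < (N:ℝ) + 1 := by positivity
    have e1 := step_sum Λ N (fun η => g η ^ 2 * Real.log (g η ^ 2))
    have e2 := step_sum Λ N (fun η => g η ^ 2)
    have e3 := step_sum Λ N (fun η => 1)
    simp only [mul_one, Finset.sum_const, nsmul_eq_mul] at e3
    rw [← e1, ← e2, ← e3, mul_div_mul_left _ _ hN.ne'] at t
    have e4 : ∑ ξ ∈ S Λ N, wt cid Λ ξ * uent Λ (fun _ => 1) (fun x => g (ad ξ x) ^ 2) ≤
        15 * ((Λ.card : ℝ) + 3) * DF cid Λ N g := by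
      unfold DF
      rw [Finset.mul_sum]
      apply Finset.sum_le_sum
      intro ξ _
      have := mul_le_mul_of_nonneg_left (lsi_one Λ hΛ (fun x => g (ad ξ x)))
        (wt_pos cidpos Λ ξ).le
      linarith
    have e5 : ((N : ℝ) + 1) * uent (S Λ (N + 1)) (wt cid Λ) (fun η => g η ^ 2) =
       ((N : ℝ) + 1) * (∑ η ∈ S Λ (N + 1), wt cid Λ η * (g η ^ 2 * Real.log (g η ^ 2))) -
       ((N : ℝ) + 1) * (∑ η ∈ S Λ (N + 1), wt cid Λ η * g η ^ 2) *
       Real.log ((∑ η ∈ S Λ (N + 1), wt cid Λ η * g η ^ 2) / ∑ η ∈ S Λ (N + 1), wt cid Λ η) := by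
      unfold uent; ring
    rw [e5]
    linarith
  induction M generalizing g with
  | zero =>
    have h := stp 0 g
    have h0 : S Λ 0 = {0} := by simp [S]
    have : ∀ x ∈ Λ, uent (S Λ 0) (wt cid Λ) (fun ξ => g (ad ξ x) ^ 2) = 0 := by
      intro x _
      rw [h0]
      unfold uent
      simp only [Finset.sum_singleton]
      rw [mul_div_cancel_left₀ _ (wt_pos cidpos Λ 0).ne']; ring
    rw [Finset.sum_eq_zero this] at h
    simpa using h
  | succ M ih =>
    have h := stp (M + 1) g
    have h2 : ∑ x ∈ Λ, uent (S Λ (M + 1)) (wt cid Λ) (fun ξ => g (ad ξ x) ^ 2) ≤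
        15 * ((Λ.card : ℝ) + 3) * ∑ x ∈ Λ, DF cid Λ M (fun ξ => g (ad ξ x)) := by
      rw [Finset.mul_sum]
      exact Finset.sum_le_sum fun x _ => ih _
    have h3 : ∑ x ∈ Λ, DF cid Λ M (fun ξ => g (ad ξ x)) = ((M:ℝ) + 1) * DF cid Λ (M + 1) g := by
      unfold DF
      rw [step_sum]
      apply Finset.sum_congr rfl; intro z _
      apply Finset.sum_congr rfl; intro ξ _
      congr 1
      apply Finset.sum_congr rfl; intro x _
      apply Finset.sum_congr rfl; intro y _
      beta_reduce
      rw [ad_comm ξ y z, ad_comm ξ x z]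
    rw [h3] at h2
    push_cast at h
    have hM : (0:ℝ) < (M:ℝ) + 1 + 1 := by positivity
    refine le_of_mul_le_mul_left ?_ hM
    linarith

end ZR

namespace ZR

/-- auxiliary gradient sum -/
def aa (Λ : Finset ℤ) (f : (ℤ → ℕ) → ℝ) (η : ℤ → ℕ) (x : ℤ) : ℝ :=
  ∑ y ∈ Λ, (f η - f (ad (rm η x) y))

lemma aa_ad (Λ : Finset ℤ) (f : (ℤ → ℕ) → ℝ) (ξ : ℤ → ℕ) (x : ℤ) :
    aa Λ f (ad ξ x) x = ∑ y ∈ Λ, (f (ad ξ x) - f (ad ξ y)) := by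
  unfold aa; rw [rm_ad]

/-- (minus) the generator -/
def TT (c : ℕ → ℝ) (Λ : Finset ℤ) : ((ℤ → ℕ) → ℝ) →ₗ[ℝ] ((ℤ → ℕ) → ℝ) where
  toFun f := fun η => ∑ x ∈ Λ, c (η x) * aa Λ f η x
  map_add' f g := by
    funext η
    simp only [Pi.add_apply, aa]
    rw [← Finset.sum_add_distrib]
    apply Finset.sum_congr rfl; intro x _
    rw [← mul_add, ← Finset.sum_add_distrib]
    congr 1
    apply Finset.sum_congr rfl; intro y _; ring
  map_smul' r f := by
    funext η
    simp only [Pi.smul_apply, smul_eq_mul, aa, RingHom.id_apply]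
    rw [Finset.mul_sum]
    apply Finset.sum_congr rfl; intro x _
    rw [mul_left_comm, Finset.mul_sum (a := r)]
    congr 1
    apply Finset.sum_congr rfl; intro y _; ring

lemma TT_apply (c : ℕ → ℝ) (Λ : Finset ℤ) (f : (ℤ → ℕ) → ℝ) (η : ℤ → ℕ) :
    TT c Λ f η = ∑ x ∈ Λ, c (η x) * aa Λ f η x := rfl

lemma sum_TT {c : ℕ → ℝ} (hc0 : c 0 = 0) (hc : ∀ n : ℕ, 0 < n → 0 < c n) (Λ : Finset ℤ) (M : ℕ)
    (f g : (ℤ → ℕ) → ℝ) :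
    ∑ η ∈ S Λ (M + 1), wt c Λ η * (TT c Λ f η * g η) =
      ∑ ξ ∈ S Λ M, wt c Λ ξ * ∑ x ∈ Λ, aa Λ f (ad ξ x) x * g (ad ξ x) := by
  have h1 : ∑ η ∈ S Λ (M + 1), wt c Λ η * (TT c Λ f η * g η) =
      ∑ x ∈ Λ, ∑ η ∈ S Λ (M + 1), wt c Λ η * (c (η x) * (aa Λ f η x * g η)) := by
    rw [Finset.sum_comm]
    apply Finset.sum_congr rfl; intro η _
    rw [TT_apply, Finset.sum_mul, Finset.mul_sum]
    apply Finset.sum_congr rfl; intro x _; ring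
  rw [h1, Finset.sum_congr rfl (fun x hx => ibp hc0 hc hx M (fun η => aa Λ f η x * g η)),
    Finset.sum_comm]
  apply Finset.sum_congr rfl; intro ξ _
  rw [Finset.mul_sum]

/-- bilinear Dirichlet form -/
def BF (c : ℕ → ℝ) (Λ : Finset ℤ) (M : ℕ) (f g : (ℤ → ℕ) → ℝ) : ℝ :=
  ∑ ξ ∈ S Λ M, ∑ x ∈ Λ, ∑ y ∈ Λ,
    wt c Λ ξ * ((f (ad ξ y) - f (ad ξ x)) * (g (ad ξ y) - g (ad ξ x)))

lemma BF_self (c : ℕ → ℝ) (Λ : Finset ℤ) (M : ℕ) (f : (ℤ → ℕ) → ℝ) :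
    BF c Λ M f f = DF c Λ M f := by
  unfold BF DF
  apply Finset.sum_congr rfl; intro ξ _
  simp only [Finset.mul_sum, sq]

lemma BF_comm (c : ℕ → ℝ) (Λ : Finset ℤ) (M : ℕ) (f g : (ℤ → ℕ) → ℝ) :
    BF c Λ M f g = BF c Λ M g f := by
  unfold BF
  simp only [mul_comm]

lemma BF_sq_le {c : ℕ → ℝ} (hc : ∀ n : ℕ, 0 < n → 0 < c n) (Λ : Finset ℤ) (M : ℕ)
    (f g : (ℤ → ℕ) → ℝ) : (BF c Λ M f g) ^ 2 ≤ DF c Λ M f * DF c Λ M g := by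
  have key : ∀ f g : (ℤ → ℕ) → ℝ, BF c Λ M f g =
      ∑ p ∈ S Λ M ×ˢ (Λ ×ˢ Λ), (Real.sqrt (wt c Λ p.1) * (f (ad p.1 p.2.2) - f (ad p.1 p.2.1))) *
        (Real.sqrt (wt c Λ p.1) * (g (ad p.1 p.2.2) - g (ad p.1 p.2.1))) := by
    intro f g
    unfold BF
    rw [Finset.sum_product]
    apply Finset.sum_congr rfl; intro ξ _
    rw [Finset.sum_product]
    apply Finset.sum_congr rfl; intro x _
    apply Finset.sum_congr rfl; intro y _
    have := Real.mul_self_sqrt (wt_pos hc Λ ξ).le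
    simp only
    linear_combination (-(f (ad ξ y) - f (ad ξ x)) * (g (ad ξ y) - g (ad ξ x))) * this
  rw [← BF_self, ← BF_self, key, key, key]
  have := Finset.sum_mul_sq_le_sq_mul_sq (S Λ M ×ˢ (Λ ×ˢ Λ))
    (fun p => Real.sqrt (wt c Λ p.1) * (f (ad p.1 p.2.2) - f (ad p.1 p.2.1)))
    (fun p => Real.sqrt (wt c Λ p.1) * (g (ad p.1 p.2.2) - g (ad p.1 p.2.1)))
  simpa only [sq] using this

lemma inner_TT {c : ℕ → ℝ} (hc0 : c 0 = 0) (hc : ∀ n : ℕ, 0 < n → 0 < c n) (Λ : Finset ℤ) (M : ℕ)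
    (f g : (ℤ → ℕ) → ℝ) :
    2 * ∑ η ∈ S Λ (M + 1), wt c Λ η * (TT c Λ f η * g η) = BF c Λ M f g := by
  rw [sum_TT hc0 hc, BF, Finset.mul_sum]
  apply Finset.sum_congr rfl; intro ξ _
  simp only [aa_ad]
  have h1 : ∑ x ∈ Λ, (∑ y ∈ Λ, (f (ad ξ x) - f (ad ξ y))) * g (ad ξ x) =
      ∑ x ∈ Λ, ∑ y ∈ Λ, (f (ad ξ x) - f (ad ξ y)) * g (ad ξ x) := by
    apply Finset.sum_congr rfl; intro x _; rw [Finset.sum_mul]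
  have h2 : ∑ x ∈ Λ, ∑ y ∈ Λ, (f (ad ξ x) - f (ad ξ y)) * g (ad ξ x) =
      ∑ x ∈ Λ, ∑ y ∈ Λ, (f (ad ξ y) - f (ad ξ x)) * g (ad ξ y) := by
    rw [Finset.sum_comm]
  have h3 : 2 * ∑ x ∈ Λ, ∑ y ∈ Λ, (f (ad ξ x) - f (ad ξ y)) * g (ad ξ x) =
      ∑ x ∈ Λ, ∑ y ∈ Λ, (f (ad ξ y) - f (ad ξ x)) * (g (ad ξ y) - g (ad ξ x)) := by
    rw [two_mul]
    nth_rewrite 2 [h2]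
    simp only [← Finset.sum_add_distrib]
    apply Finset.sum_congr rfl; intro x _
    apply Finset.sum_congr rfl; intro y _; ring
  rw [h1, mul_left_comm, h3]
  simp only [Finset.mul_sum]

lemma sq_id (Λ : Finset ℤ) (a : ℤ → ℝ) :
    2 * ∑ x ∈ Λ, (∑ y ∈ Λ, (a x - a y)) ^ 2 = Λ.card * ∑ x ∈ Λ, ∑ y ∈ Λ, (a y - a x) ^ 2 := by
  have h1 : ∀ x, ∑ y ∈ Λ, (a x - a y) = Λ.card * a x - ∑ y ∈ Λ, a y := by
    intro x; rw [Finset.sum_sub_distrib]; simp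
  have h2 : ∀ x, ∑ y ∈ Λ, (a y - a x) ^ 2 =
      ∑ y ∈ Λ, a y ^ 2 - 2 * a x * ∑ y ∈ Λ, a y + Λ.card * a x ^ 2 := by
    intro x
    simp only [sub_sq, Finset.sum_add_distrib, Finset.sum_sub_distrib, Finset.sum_const,
      nsmul_eq_mul, Finset.mul_sum]
    congr 2
    apply Finset.sum_congr rfl; intro y _; ring
  simp only [h1, h2]
  set K : ℝ := (Λ.card : ℝ)
  set s := ∑ y ∈ Λ, a y with hs
  set q := ∑ y ∈ Λ, a y ^ 2 with hq
  have e1 : ∑ x ∈ Λ, (K * a x - s) ^ 2 = K ^ 2 * q - 2 * K * s * s + K * s ^ 2 := by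
    simp only [sub_sq, Finset.sum_add_distrib, Finset.sum_sub_distrib, Finset.sum_const,
      nsmul_eq_mul, mul_pow, ← Finset.mul_sum, ← Finset.sum_mul, mul_assoc, ← hs, ← hq]
    ring
  have e2 : ∑ x ∈ Λ, (q - 2 * a x * s + K * a x ^ 2) = K * q - 2 * s * s + K * q := by
    simp only [Finset.sum_add_distrib, Finset.sum_sub_distrib, Finset.sum_const,
      nsmul_eq_mul, ← Finset.mul_sum, ← Finset.sum_mul, ← hs, ← hq]
    rfl
  rw [e1, e2]; ring

lemma off_nonneg (Λ : Finset ℤ) (F : ℤ → ℤ → ℝ) (hF : ∀ x y, F x y = F y x) :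
    0 ≤ ∑ x ∈ Λ, ∑ z ∈ Λ, (∑ y ∈ Λ, (F z x - F z y)) * (∑ u ∈ Λ, (F x z - F x u)) := by
  rcases Λ.eq_empty_or_nonempty with rfl | hΛ
  · simp
  set K : ℝ := (Λ.card : ℝ) with hKd
  have hK : 0 < K := by rw [hKd]; exact_mod_cast Finset.card_pos.2 hΛ
  set r : ℤ → ℝ := fun x => ∑ y ∈ Λ, F x y with hr
  set s := ∑ x ∈ Λ, r x with hs
  have h1 : ∀ z x, ∑ y ∈ Λ, (F z x - F z y) = K * F z x - r z := by
    intro z x; rw [Finset.sum_sub_distrib]; simp [hKd, hr]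
  have hr' : ∀ x, ∑ y ∈ Λ, F y x = r x := by
    intro x; rw [hr]; exact Finset.sum_congr rfl fun y _ => hF _ _
  simp only [h1]
  set q := ∑ x ∈ Λ, ∑ z ∈ Λ, F x z ^ 2 with hq
  set p := ∑ x ∈ Λ, r x ^ 2 with hp
  have e1 : ∑ x ∈ Λ, ∑ z ∈ Λ, (K * F z x - r z) * (K * F x z - r x) =
      K ^ 2 * q - 2 * K * p + s ^ 2 := by
    have : ∀ x z, (K * F z x - r z) * (K * F x z - r x) =
        K ^ 2 * F x z ^ 2 - K * (F x z * r x) - K * (F x z * r z) + r x * r z := by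
      intro x z; rw [hF z x]; ring
    simp only [this, Finset.sum_add_distrib, Finset.sum_sub_distrib, ← Finset.mul_sum, ← hq,
      ← Finset.sum_mul]
    rw [Finset.sum_comm (f := fun x z => F x z * r z)]
    simp only [← Finset.sum_mul, hr', ← hs]
    change K ^ 2 * q - K * ∑ x ∈ Λ, r x * r x - K * ∑ x ∈ Λ, r x * r x + s * s = _
    simp only [← sq, ← hp]; ring
  have e2 : ∑ x ∈ Λ, ∑ z ∈ Λ, (K * F x z - r x - r z + s / K) ^ 2 =
      K ^ 2 * q - 2 * K * p + s ^ 2 := by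
    have : ∀ x z, (K * F x z - r x - r z + s / K) ^ 2 =
        K ^ 2 * F x z ^ 2 - 2 * K * (F x z * r x) - 2 * K * (F x z * r z) + 2 * s * F x z
         + 2 * (r x * r z) + r x ^ 2 + r z ^ 2 - 2 * (s / K) * r x - 2 * (s / K) * r z
         + (s / K) ^ 2 := by
      intro x z; field_simp; ring
    simp only [this, Finset.sum_add_distrib, Finset.sum_sub_distrib, ← Finset.mul_sum, ← hq,
      ← Finset.sum_mul, Finset.sum_const, nsmul_eq_mul, ← hKd]
    rw [Finset.sum_comm (f := fun x z => F x z * r z)]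
    simp only [← Finset.sum_mul, hr', ← hs, ← hp]
    change K ^ 2 * q - 2 * K * ∑ x ∈ Λ, r x * r x - 2 * K * ∑ x ∈ Λ, r x * r x + 2 * s * s
      + _ + _ + _ - _ - _ + _ = _
    simp only [← sq, ← hp]; field_simp; ring
  rw [e1, ← e2]
  exact Finset.sum_nonneg fun _ _ => Finset.sum_nonneg fun _ _ => sq_nonneg _

/-- Bakry-Emery type inequality -/
lemma bakry {c : ℕ → ℝ} (hc0 : c 0 = 0) (hc : ∀ n : ℕ, 0 < n → 0 < c n) {δ : ℝ}
    (hδ : ∀ k, δ ≤ c (k + 1) - c k) (Λ : Finset ℤ) (M : ℕ) (f : (ℤ → ℕ) → ℝ) :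
    δ * Λ.card * DF c Λ M f ≤ 2 * ∑ η ∈ S Λ (M + 1), wt c Λ η * (TT c Λ f η * TT c Λ f η) := by
  rw [sum_TT hc0 hc]
  have hT : ∀ ξ x, x ∈ Λ → TT c Λ f (ad ξ x) = ∑ z ∈ Λ, c (ξ z) * aa Λ f (ad ξ x) z
      + (c (ξ x + 1) - c (ξ x)) * aa Λ f (ad ξ x) x := by
    intro ξ x hx
    rw [TT_apply]
    have : ∀ z ∈ Λ, c (ad ξ x z) * aa Λ f (ad ξ x) z = c (ξ z) * aa Λ f (ad ξ x) z +
        if z = x then (c (ξ x + 1) - c (ξ x)) * aa Λ f (ad ξ x) x else 0 := by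
      intro z _
      by_cases h : z = x
      · subst h; rw [ad_self]; simp; ring
      · rw [ad_ne _ h]; simp [h]
    rw [Finset.sum_congr rfl this, Finset.sum_add_distrib]
    simp [hx]
  have e : ∑ ξ ∈ S Λ M, wt c Λ ξ * ∑ x ∈ Λ, aa Λ f (ad ξ x) x * TT c Λ f (ad ξ x) =
      ∑ ξ ∈ S Λ M, wt c Λ ξ * (∑ x ∈ Λ, (c (ξ x + 1) - c (ξ x)) * aa Λ f (ad ξ x) x ^ 2) +
      ∑ x ∈ Λ, ∑ z ∈ Λ, ∑ ξ ∈ S Λ M, wt c Λ ξ *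
        (c (ξ z) * (aa Λ f (ad ξ x) x * aa Λ f (ad ξ x) z)) := by
    have : ∑ x ∈ Λ, ∑ z ∈ Λ, ∑ ξ ∈ S Λ M, wt c Λ ξ *
        (c (ξ z) * (aa Λ f (ad ξ x) x * aa Λ f (ad ξ x) z)) =
        ∑ ξ ∈ S Λ M, wt c Λ ξ * ∑ x ∈ Λ, ∑ z ∈ Λ,
        (c (ξ z) * (aa Λ f (ad ξ x) x * aa Λ f (ad ξ x) z)) := by
      simp only [Finset.mul_sum]
      rw [Finset.sum_comm (s := S Λ M)]
      apply Finset.sum_congr rfl; intro x _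
      rw [Finset.sum_comm]
    rw [this, ← Finset.sum_add_distrib]
    apply Finset.sum_congr rfl; intro ξ _
    rw [← mul_add, ← Finset.sum_add_distrib]
    congr 1
    apply Finset.sum_congr rfl; intro x hx
    rw [hT ξ x hx, mul_add, Finset.mul_sum, add_comm]
    congr 1
    · ring
    · apply Finset.sum_congr rfl; intro z _; ring
  have off : 0 ≤ ∑ x ∈ Λ, ∑ z ∈ Λ, ∑ ξ ∈ S Λ M, wt c Λ ξ *
        (c (ξ z) * (aa Λ f (ad ξ x) x * aa Λ f (ad ξ x) z)) := by
    rcases M with _ | M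
    · apply le_of_eq; symm
      apply Finset.sum_eq_zero; intro x _
      apply Finset.sum_eq_zero; intro z hz
      apply Finset.sum_eq_zero; intro ξ hξ
      have := le_of_mem hz hξ
      have : ξ z = 0 := by omega
      rw [this, hc0]; simp
    · rw [Finset.sum_congr rfl (fun x _ => Finset.sum_congr rfl (fun z hz =>
        ibp hc0 hc hz M (fun ξ => aa Λ f (ad ξ x) x * aa Λ f (ad ξ x) z)))]
      have : ∑ x ∈ Λ, ∑ z ∈ Λ, ∑ ξ ∈ S Λ M, wt c Λ ξ *
          (aa Λ f (ad (ad ξ z) x) x * aa Λ f (ad (ad ξ z) x) z) =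
        ∑ ξ ∈ S Λ M, wt c Λ ξ * ∑ x ∈ Λ, ∑ z ∈ Λ,
          (aa Λ f (ad (ad ξ z) x) x * aa Λ f (ad (ad ξ z) x) z) := by
        simp only [Finset.mul_sum]
        rw [Finset.sum_comm (s := S Λ M)]
        apply Finset.sum_congr rfl; intro x _
        rw [Finset.sum_comm]
      rw [this]
      apply Finset.sum_nonneg; intro ξ _
      apply mul_nonneg (wt_pos hc _ _).le
      have := off_nonneg Λ (fun x y => f (ad (ad ξ x) y)) (fun x y => by rw [ad_comm])
      refine this.trans (le_of_eq ?_)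
      apply Finset.sum_congr rfl; intro x _
      apply Finset.sum_congr rfl; intro z _
      rw [aa_ad, ad_comm ξ z x, aa_ad]
  rw [e]
  have dg : δ * Λ.card * DF c Λ M f ≤
      2 * ∑ ξ ∈ S Λ M, wt c Λ ξ * (∑ x ∈ Λ, (c (ξ x + 1) - c (ξ x)) * aa Λ f (ad ξ x) x ^ 2) := by
    unfold DF
    rw [Finset.mul_sum, Finset.mul_sum]
    apply Finset.sum_le_sum; intro ξ _
    have h1 : δ * ∑ x ∈ Λ, aa Λ f (ad ξ x) x ^ 2 ≤
        ∑ x ∈ Λ, (c (ξ x + 1) - c (ξ x)) * aa Λ f (ad ξ x) x ^ 2 := by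
      rw [Finset.mul_sum]
      exact Finset.sum_le_sum fun x _ => mul_le_mul_of_nonneg_right (hδ _) (sq_nonneg _)
    have h2 := sq_id Λ (fun x => f (ad ξ x))
    simp only [aa_ad] at h1 ⊢
    have h3 := mul_le_mul_of_nonneg_left h1 (wt_pos hc Λ ξ).le
    calc _ = wt c Λ ξ * δ * (Λ.card * ∑ x ∈ Λ, ∑ y ∈ Λ, (f (ad ξ y) - f (ad ξ x)) ^ 2) := by ring
      _ = 2 * (wt c Λ ξ * (δ * ∑ x ∈ Λ, (∑ y ∈ Λ, (f (ad ξ x) - f (ad ξ y))) ^ 2)) := by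
        rw [← h2]; ring
      _ ≤ _ := by linarith
  linarith

lemma conn {Λ : Finset ℤ} (hΛ : Λ.Nonempty) (M : ℕ) (f : (ℤ → ℕ) → ℝ)
    (h : ∀ ξ ∈ S Λ M, ∀ x ∈ Λ, ∀ y ∈ Λ, f (ad ξ x) = f (ad ξ y)) :
    ∀ η ∈ S Λ (M + 1), ∀ η' ∈ S Λ (M + 1), f η = f η' := by
  obtain ⟨x0, hx0⟩ := hΛ
  have hex : ∀ N : ℕ, ∀ η ∈ S Λ (N + 1), ∃ x ∈ Λ, ∃ ξ ∈ S Λ N, η = ad ξ x := by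
    intro N η hη
    have h1 := (mem_S.1 hη).1
    have : ∃ x ∈ Λ, η x ≠ 0 := by
      by_contra! hcon
      rw [Finset.sum_eq_zero hcon] at h1
      omega
    obtain ⟨x, hx, h0⟩ := this
    exact ⟨x, hx, rm η x, rm_mem hx hη h0, (ad_rm _ _ h0).symm⟩
  induction M generalizing f with
  | zero =>
    intro η hη η' hη'
    obtain ⟨x, hx, ξ, hξ, rfl⟩ := hex 0 η hη
    obtain ⟨y, hy, ζ, hζ, rfl⟩ := hex 0 η' hη'
    have h0 : S Λ 0 = {0} := by simp [S]
    have e1 : ξ = 0 := by rw [h0] at hξ; simpa using hξ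
    have e2 : ζ = 0 := by rw [h0] at hζ; simpa using hζ
    subst e1; subst e2
    exact h _ hξ x hx y hy
  | succ M ih =>
    intro η hη η' hη'
    obtain ⟨x, hx, ξ, hξ, rfl⟩ := hex _ η hη
    obtain ⟨y, hy, ζ, hζ, rfl⟩ := hex _ η' hη'
    rw [h ξ hξ x hx x0 hx0, h ζ hζ y hy x0 hx0]
    refine ih (fun ξ => f (ad ξ x0)) ?_ ξ hξ ζ hζ
    intro ω hω u hu v hv
    rw [ad_comm ω u, ad_comm ω v]
    exact h _ (ad_mem hx0 hω) u hu v hv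

/-- spectral gap -/
lemma gap0 {c : ℕ → ℝ} (hc0 : c 0 = 0) (hc : ∀ n : ℕ, 0 < n → 0 < c n) {δ : ℝ} (hδ0 : 0 < δ)
    (hδ : ∀ k, δ ≤ c (k + 1) - c k) {Λ : Finset ℤ} (hΛ : Λ.Nonempty) (M : ℕ)
    (f : (ℤ → ℕ) → ℝ) :
    ∃ a : ℝ, 2 * δ * Λ.card * ∑ η ∈ S Λ (M + 1), wt c Λ η * (f η - a) ^ 2 ≤ DF c Λ M f := by
  set s := S Λ (M + 1) with hs
  set E : (s → ℝ) →ₗ[ℝ] ((ℤ → ℕ) → ℝ) :=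
    Function.ExtendByZero.linearMap ℝ (Subtype.val : s → (ℤ → ℕ)) with hE
  have hEa : ∀ (v : s → ℝ) (η : s), E v η = v η := by
    intro v η
    rw [hE, Function.ExtendByZero.linearMap_apply]
    exact Subtype.val_injective.extend_apply _ _ _
  set R : ((ℤ → ℕ) → ℝ) →ₗ[ℝ] (s → ℝ) := LinearMap.funLeft ℝ ℝ (Subtype.val : s → (ℤ → ℕ)) with hR
  have hRa : ∀ (g : (ℤ → ℕ) → ℝ) (η : s), R g η = g η := fun g η => rfl
  set T : (s → ℝ) →ₗ[ℝ] (s → ℝ) := R ∘ₗ TT c Λ ∘ₗ E with hT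
  have hTa : ∀ (v : s → ℝ) (η : s), T v η = TT c Λ (E v) η := fun v η => rfl
  have hsum : ∀ (u v : s → ℝ), ∑ η ∈ s, wt c Λ η * (TT c Λ (E u) η * E v η) =
      ∑ η : s, wt c Λ η * (T u η * v η) := by
    intro u v
    rw [← Finset.sum_coe_sort]
    apply Finset.sum_congr rfl; intro η _
    rw [hTa, hEa]
  have hsym : ∀ (u v : s → ℝ), ∑ η : s, wt c Λ η * (T u η * v η) =
      ∑ η : s, wt c Λ η * (T v η * u η) := by
    intro u v
    have h1 := inner_TT hc0 hc Λ M (E u) (E v)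
    have h2 := inner_TT hc0 hc Λ M (E v) (E u)
    rw [BF_comm] at h2
    rw [← hsum, ← hsum]; linarith
  have hzero : ∀ v : s → ℝ, ∑ η : s, wt c Λ η * (v η * v η) = 0 → v = 0 := by
    intro v h
    rw [Finset.sum_eq_zero_iff_of_nonneg
      (fun η _ => mul_nonneg (wt_pos hc _ _).le (mul_self_nonneg _))] at h
    funext η
    have := h η (Finset.mem_univ _)
    simpa [(wt_pos hc Λ η).ne'] using this
  have hdis : Disjoint (LinearMap.ker T) (LinearMap.range T) := by
    rw [Submodule.disjoint_def]
    rintro v hv ⟨u, rfl⟩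
    apply hzero
    rw [hsym, LinearMap.mem_ker.1 hv]
    simp
  have htop : LinearMap.ker T ⊔ LinearMap.range T = ⊤ := by
    apply Submodule.eq_top_of_disjoint _ _ _ hdis
    have := LinearMap.finrank_range_add_finrank_ker T
    omega
  have hf : R f ∈ LinearMap.ker T ⊔ LinearMap.range T := by rw [htop]; trivial
  obtain ⟨k, hk, _, ⟨u, rfl⟩, hku⟩ := Submodule.mem_sup.1 hf
  have hDk : DF c Λ M (E k) = 0 := by
    rw [← BF_self, ← inner_TT hc0 hc, ← hs, hsum, LinearMap.mem_ker.1 hk]; simp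
  have hcst : ∀ ξ ∈ S Λ M, ∀ x ∈ Λ, ∀ y ∈ Λ, E k (ad ξ x) = E k (ad ξ y) := by
    intro ξ hξ x hx y hy
    unfold DF at hDk
    rw [Finset.sum_eq_zero_iff_of_nonneg (fun ξ _ => mul_nonneg (wt_pos hc _ _).le
      (Finset.sum_nonneg fun _ _ => Finset.sum_nonneg fun _ _ => sq_nonneg _))] at hDk
    have h1 := (mul_eq_zero.1 (hDk ξ hξ)).resolve_left (wt_pos hc _ _).ne'
    rw [Finset.sum_eq_zero_iff_of_nonneg
      (fun _ _ => Finset.sum_nonneg fun _ _ => sq_nonneg _)] at h1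
    have h2 := h1 x hx
    rw [Finset.sum_eq_zero_iff_of_nonneg (fun _ _ => sq_nonneg _)] at h2
    have h3 := h2 y hy
    have := pow_eq_zero_iff two_ne_zero |>.1 h3
    linarith
  have hcc := conn hΛ M (E k) hcst
  obtain ⟨η0, hη0⟩ := S_nonempty hΛ (M + 1)
  refine ⟨E k η0, ?_⟩
  -- f - a = T u on s
  have hfa : ∀ η ∈ s, f η - E k η0 = TT c Λ (E u) η := by
    intro η hη
    rw [hcc η0 hη0 η hη]
    have := congrFun hku ⟨η, hη⟩
    rw [Pi.add_apply, hRa, hTa] at this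
    have h2 := hEa k ⟨η, hη⟩
    simp only at this h2
    rw [h2]; linarith
  set X := ∑ η ∈ s, wt c Λ η * (f η - E k η0) ^ 2 with hX
  have hX1 : X = ∑ η ∈ s, wt c Λ η * (TT c Λ (E u) η * TT c Λ (E u) η) := by
    rw [hX]; apply Finset.sum_congr rfl; intro η hη; rw [hfa η hη, sq]
  have hX2 : 2 * X = BF c Λ M (E u) f := by
    have hb : BF c Λ M (E u) f = BF c Λ M (E u) (fun η => f η - E k η0) := by
      unfold BF; simp only [sub_sub_sub_cancel_right]
    rw [hb, ← inner_TT hc0 hc, ← hs, hX]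
    congr 1
    apply Finset.sum_congr rfl; intro η hη; rw [hfa η hη, sq]
  have hX0 : 0 ≤ X := Finset.sum_nonneg fun η _ => mul_nonneg (wt_pos hc _ _).le (sq_nonneg _)
  have hbk := bakry hc0 hc hδ Λ M (E u)
  rw [← hs, ← hX1] at hbk
  have hcs := BF_sq_le hc Λ M (E u) f
  rw [← hX2] at hcs
  have hDf := DF_nonneg hc Λ M f
  have hDu := DF_nonneg hc Λ M (E u)
  have hK : (0:ℝ) < Λ.card := by exact_mod_cast Finset.card_pos.2 hΛ
  rcases hX0.eq_or_lt with h0 | h0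
  · rw [← h0]; simpa using hDf
  · have h1 : δ * Λ.card * (2 * X) ^ 2 ≤ (2 * X) * DF c Λ M f := by
      calc δ * Λ.card * (2 * X) ^ 2 ≤ δ * Λ.card * (DF c Λ M (E u) * DF c Λ M f) :=
            mul_le_mul_of_nonneg_left hcs (by positivity)
        _ = (δ * Λ.card * DF c Λ M (E u)) * DF c Λ M f := by ring
        _ ≤ _ := mul_le_mul_of_nonneg_right hbk hDf
    have h2 : (2 * X) * (2 * δ * Λ.card * X) ≤ (2 * X) * DF c Λ M f := by nlinarith
    exact le_of_mul_le_mul_left h2 (by positivity)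

end ZR

namespace ZR

lemma c_lip {c : ℕ → ℝ} {a₁ : ℝ} (hLG : ∀ k : ℕ, |c (k + 1) - c k| ≤ a₁) (n j : ℕ) :
    |c (n + j) - c n| ≤ a₁ * j := by
  induction j with
  | zero => simp
  | succ j ih =>
    have h1 := hLG (n + j)
    have h2 : c (n + (j + 1)) - c n = (c (n + j + 1) - c (n + j)) + (c (n + j) - c n) := by
      rw [← add_assoc]; ring
    rw [h2]
    refine (abs_add_le _ _).trans ?_
    push_cast; linarith

lemma c_lip' {c : ℕ → ℝ} {a₁ : ℝ} (hLG : ∀ k : ℕ, |c (k + 1) - c k| ≤ a₁) (m n : ℕ) :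
    |c m - c n| ≤ a₁ * |(m : ℝ) - n| := by
  rcases le_total n m with h | h
  · obtain ⟨j, rfl⟩ := Nat.exists_eq_add_of_le h
    have := c_lip hLG n j
    have e : |((n + j : ℕ) : ℝ) - n| = j := by push_cast; rw [add_sub_cancel_left]; simp
    rw [e]; exact this
  · obtain ⟨j, rfl⟩ := Nat.exists_eq_add_of_le h
    have := c_lip hLG m j
    have e : |(m : ℝ) - ((m + j : ℕ) : ℝ)| = j := by push_cast; rw [sub_add_cancel_left]; simp
    rw [e, abs_sub_comm]; exact this

lemma c_upper {c : ℕ → ℝ} {a₁ : ℝ} (hc0 : c 0 = 0) (hLG : ∀ k : ℕ, |c (k + 1) - c k| ≤ a₁)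
    (n : ℕ) : c n ≤ a₁ * n := by
  have := c_lip hLG 0 n
  rw [hc0] at this; simp at this
  exact (le_abs_self _).trans this

lemma c_diff {c : ℕ → ℝ} {a₁ a₂ : ℝ} {k₀ : ℕ} (hLG : ∀ k : ℕ, |c (k + 1) - c k| ≤ a₁)
    (hk₀ : 0 < k₀) (ha₂ : 0 < a₂) (hM : ∀ j k : ℕ, j + k₀ ≤ k → a₂ ≤ c k - c j) :
    ∃ B : ℝ, 0 < B ∧ ∀ m n : ℕ, |(m : ℝ) - n| ≤ B * (|c m - c n| + 1) := by
  have ha₁ : 0 ≤ a₁ := (abs_nonneg _).trans (hLG 0)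
  have hk : (0:ℝ) < k₀ := by exact_mod_cast hk₀
  have main : ∀ n j : ℕ, (j : ℝ) ≤ (k₀ / a₂ + k₀ * (a₁ * k₀ / a₂ + 1)) * (|c (n + j) - c n| + 1) := by
    intro n j
    have h1 : ∀ q r : ℕ, q * a₂ ≤ c (n + r + q * k₀) - c (n + r) := by
      intro q r
      induction q with
      | zero => simp
      | succ q ih =>
        have := hM (n + r + q * k₀) (n + r + (q + 1) * k₀) (by ring_nf; omega)
        push_cast; linarith
    have h2 := h1 (j / k₀) (j % k₀)
    have e : n + j % k₀ + j / k₀ * k₀ = n + j := by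
      have := Nat.mod_add_div j k₀; rw [mul_comm] at this; omega
    rw [e] at h2
    have h3 := (abs_le.1 (c_lip hLG n (j % k₀))).1
    have h4 : ((j % k₀ : ℕ) : ℝ) ≤ k₀ := by exact_mod_cast (Nat.mod_lt _ hk₀).le
    have h5 : (j : ℝ) ≤ k₀ * (j / k₀ : ℕ) + k₀ := by
      have := Nat.mod_add_div j k₀
      have h6 := Nat.mod_lt j hk₀
      exact_mod_cast (by omega : j ≤ k₀ * (j / k₀) + k₀)
    have h7 : ((j / k₀ : ℕ) : ℝ) * a₂ ≤ |c (n + j) - c n| + a₁ * k₀ := by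
      have := le_abs_self (c (n + j) - c n)
      have := mul_le_mul_of_nonneg_left h4 ha₁
      linarith
    have h8 : ((j / k₀ : ℕ) : ℝ) ≤ (|c (n + j) - c n| + a₁ * k₀) / a₂ := by
      rwa [le_div_iff₀ ha₂]
    have h9 := mul_le_mul_of_nonneg_left h8 hk.le
    have h10 : 0 ≤ |c (n + j) - c n| := abs_nonneg _
    have h11 : 0 ≤ k₀ * (a₁ * k₀ / a₂ + 1) * |c (n + j) - c n| := by positivity
    have h12 : 0 ≤ k₀ / a₂ := by positivity
    have e3 : k₀ * ((|c (n + j) - c n| + a₁ * k₀) / a₂) =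
      k₀ / a₂ * |c (n + j) - c n| + k₀ * (a₁ * k₀ / a₂) := by ring
    nlinarith
  refine ⟨k₀ / a₂ + k₀ * (a₁ * k₀ / a₂ + 1), by positivity, fun m n => ?_⟩
  rcases le_total n m with h | h
  · obtain ⟨j, rfl⟩ := Nat.exists_eq_add_of_le h
    have e : |((n + j : ℕ) : ℝ) - n| = j := by push_cast; rw [add_sub_cancel_left]; simp
    rw [e]; exact main n j
  · obtain ⟨j, rfl⟩ := Nat.exists_eq_add_of_le h
    have e : |(m : ℝ) - ((m + j : ℕ) : ℝ)| = j := by push_cast; rw [sub_add_cancel_left]; simp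
    rw [e, abs_sub_comm (c m)]; exact main m j

lemma c_lower {c : ℕ → ℝ} (hc0 : c 0 = 0) (hcpos : ∀ n : ℕ, 0 < n → 0 < c n) {B : ℝ}
    (hB0 : 0 < B) (hB : ∀ m n : ℕ, |(m : ℝ) - n| ≤ B * (|c m - c n| + 1)) :
    ∃ δ : ℝ, 0 < δ ∧ ∀ n : ℕ, δ * n ≤ c n := by
  have hnn : ∀ n, 0 ≤ c n := fun n => by
    rcases Nat.eq_zero_or_pos n with rfl | h
    · rw [hc0]
    · exact (hcpos n h).le
  have fin : ∀ N0 : ℕ, ∃ δ : ℝ, 0 < δ ∧ ∀ n : ℕ, n ≤ N0 → δ * n ≤ c n := by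
    intro N0
    induction N0 with
    | zero => exact ⟨1, one_pos, fun n hn => by
        have : n = 0 := by omega
        subst this; simp [hc0]⟩
    | succ k ih =>
      obtain ⟨δ, h0, h⟩ := ih
      have hk : (0:ℝ) < (k + 1 : ℕ) := by positivity
      refine ⟨min δ (c (k + 1) / (k + 1 : ℕ)), lt_min h0 (div_pos (hcpos _ (Nat.succ_pos _)) hk),
        fun n hn => ?_⟩
      rcases Nat.lt_or_ge n (k + 1) with h1 | h1
      · exact (mul_le_mul_of_nonneg_right (min_le_left _ _) (Nat.cast_nonneg n)).trans
          (h n (by omega))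
      · have : n = k + 1 := by omega
        subst this
        refine (mul_le_mul_of_nonneg_right (min_le_right _ _) hk.le).trans (le_of_eq ?_)
        field_simp
  obtain ⟨N0, hN0⟩ := exists_nat_ge (2 * B)
  obtain ⟨δ, h0, h⟩ := fin N0
  refine ⟨min δ (1 / (2 * B)), lt_min h0 (by positivity), fun n => ?_⟩
  rcases le_total n N0 with h1 | h1
  · exact (mul_le_mul_of_nonneg_right (min_le_left _ _) (Nat.cast_nonneg n)).trans (h n h1)
  · refine (mul_le_mul_of_nonneg_right (min_le_right _ _) (Nat.cast_nonneg n)).trans ?_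
    have h2 := hB n 0
    rw [hc0] at h2
    simp only [Nat.cast_zero, sub_zero, abs_of_nonneg (hnn n), Nat.abs_cast] at h2
    have h3 : (N0 : ℝ) ≤ n := by exact_mod_cast h1
    have h4 : (1:ℝ) ≤ c n := by
      by_contra hlt
      push Not at hlt
      nlinarith
    rw [div_mul_eq_mul_div, one_mul, div_le_iff₀ (by positivity)]
    nlinarith

lemma log_lip {x y ε D : ℝ} (hε : 0 < ε) (hx : ε ≤ x) (hy : ε ≤ y) (h : |x - y| ≤ D) :
    |Real.log x - Real.log y| ≤ D / ε := by
  have hx0 : 0 < x := lt_of_lt_of_le hε hx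
  have hy0 : 0 < y := lt_of_lt_of_le hε hy
  have hD : 0 ≤ D := (abs_nonneg _).trans h
  have key : ∀ u v : ℝ, ε ≤ u → ε ≤ v → |u - v| ≤ D → Real.log u - Real.log v ≤ D / ε := by
    intro u v hu hv huv
    have hu0 : 0 < u := lt_of_lt_of_le hε hu
    have hv0 : 0 < v := lt_of_lt_of_le hε hv
    have h1 := Real.log_le_sub_one_of_pos (div_pos hu0 hv0)
    rw [Real.log_div hu0.ne' hv0.ne'] at h1
    refine h1.trans ?_
    have : u / v - 1 = (u - v) / v := by field_simp
    rw [this]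
    exact div_le_div₀ hD ((le_abs_self _).trans huv) hε hv
  rw [abs_le]
  have h1 := key x y hx hy h
  have h2 := key y x hy hx (by rwa [abs_sub_comm])
  constructor <;> linarith

/-- regularisation of the rate function -/
lemma exists_ct {c : ℕ → ℝ} {a₁ a₂ δ₁ : ℝ} {k₀ : ℕ} (hc0 : c 0 = 0)
    (hcpos : ∀ n : ℕ, 0 < n → 0 < c n) (hLG : ∀ k : ℕ, |c (k + 1) - c k| ≤ a₁) (ha₂ : 0 < a₂)
    (hM : ∀ j k : ℕ, j + k₀ ≤ k → a₂ ≤ c k - c j) (hδ₁ : 0 < δ₁) (hlow : ∀ n : ℕ, δ₁ * n ≤ c n) :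
    ∃ (ct : ℕ → ℝ) (δ b : ℝ), ct 0 = 0 ∧ (∀ n : ℕ, 0 < n → 0 < ct n) ∧ 0 < δ ∧
      (∀ k, δ ≤ ct (k + 1) - ct k) ∧ 0 < b ∧
      ∀ n, cfact ct n ≤ b * cfact c n ∧ cfact c n ≤ b * cfact ct n := by
  have ha₁ : 0 < a₁ := by
    have h1 := hLG 0
    have h2 := hcpos 1 one_pos
    rw [hc0] at h1; simp at h1
    exact lt_of_lt_of_le (abs_pos.2 h2.ne') h1
  set r := k₀ with hr
  set ε := δ₁ / 2 with hε
  have hε0 : 0 < ε := by positivity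
  set m : ℕ := 2 * r + 1 with hm
  have hm0 : (0:ℝ) < m := by rw [hm]; positivity
  set p : ℕ → ℝ := fun i => if i ≤ r then ε else c (i - r) with hp
  have hp1 : ∀ i, i ≤ r → p i = ε := fun i h => by simp [hp, h]
  have hp2 : ∀ n, 0 < n → p (n + r) = c n := fun n h => by
    have : ¬ n + r ≤ r := by omega
    simp only [hp]; rw [if_neg this, Nat.add_sub_cancel]
  have hpε : ∀ i, ε ≤ p i := by
    intro i
    rcases le_or_gt i r with h | h
    · rw [hp1 i h]
    · have e : i = (i - r) + r := by omega
      rw [e, hp2 _ (by omega)]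
      refine le_trans ?_ (hlow _)
      have : (1:ℝ) ≤ ((i - r : ℕ) : ℝ) := by exact_mod_cast (by omega : 1 ≤ i - r)
      rw [hε]; nlinarith
  have hp0 : ∀ i, 0 < p i := fun i => lt_of_lt_of_le hε0 (hpε i)
  set ℓ : ℕ → ℝ := fun i => Real.log (p i) with hℓ
  set B := (a₁ + ε) / ε with hB
  have hB0 : 0 < B := by positivity
  have hℓ1 : ∀ i, |ℓ (i + 1) - ℓ i| ≤ B := by
    intro i
    apply log_lip hε0 (hpε _) (hpε _)
    rcases lt_trichotomy i r with h | h | h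
    · rw [hp1 i h.le, hp1 (i + 1) h]; simp; positivity
    · subst h
      rw [hp1 i le_rfl, add_comm i 1, hp2 1 one_pos]
      have h1 := hLG 0
      rw [hc0] at h1; simp only [zero_add, sub_zero] at h1
      refine (abs_sub _ _).trans ?_
      rw [abs_of_pos hε0]; linarith
    · obtain ⟨t, rfl⟩ : ∃ t, i = t + r := ⟨i - r, by omega⟩
      rw [hp2 t (by omega), show t + r + 1 = (t + 1) + r by ring, hp2 (t + 1) (by omega)]
      linarith [hLG t]
  have hℓj : ∀ n j, |ℓ (n + j) - ℓ n| ≤ B * j := fun n j => c_lip hℓ1 n j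
  -- the regularised function
  set ct : ℕ → ℝ := fun k => if k = 0 then 0 else
    Real.exp ((1 / m) * ∑ j ∈ Finset.range m, ℓ (k + j)) with hct
  have hct0 : ct 0 = 0 := by simp [hct]
  have hcts : ∀ k, 0 < k → ct k = Real.exp ((1 / m) * ∑ j ∈ Finset.range m, ℓ (k + j)) := by
    intro k hk; simp only [hct]; rw [if_neg hk.ne']
  have hctpos : ∀ n : ℕ, 0 < n → 0 < ct n := fun n hn => by rw [hcts n hn]; exact Real.exp_pos _
  set θ := min 1 (a₂ / a₁) with hθ
  have hθ0 : 0 < θ := lt_min one_pos (by positivity)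
  have hstep : ∀ k, 0 < k → θ / (2 * k) ≤ ℓ (k + m) - ℓ k := by
    intro k hk
    have hk' : (1:ℝ) ≤ k := by exact_mod_cast hk
    have hy : θ / k ≤ 1 := by
      rw [div_le_one (by linarith)]; exact (min_le_left _ _).trans hk'
    have hy0 : 0 ≤ θ / k := by positivity
    have hpk : p k * (1 + θ / k) ≤ p (k + m) := by
      have e : k + m = (k + r + 1) + r := by rw [hm]; ring
      rw [e, hp2 _ (by omega)]
      rcases le_or_gt k r with h | h
      · rw [hp1 k h]
        refine le_trans ?_ (hlow _)
        have : (1:ℝ) ≤ ((k + r + 1 : ℕ) : ℝ) := by exact_mod_cast (by omega : 1 ≤ k + r + 1)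
        rw [hε]; nlinarith
      · obtain ⟨t, rfl⟩ : ∃ t, k = t + r := ⟨k - r, by omega⟩
        rw [hp2 t (by omega)]
        have h1 := hM t (t + r + r + 1) (by omega)
        have h2 := c_upper hc0 hLG t
        have h3 : c t * (θ / ((t + r : ℕ) : ℝ)) ≤ a₂ := by
          have h4 : θ ≤ a₂ / a₁ := min_le_right _ _
          have h5 : c t ≤ a₁ * ((t + r : ℕ) : ℝ) := by
            refine h2.trans (mul_le_mul_of_nonneg_left ?_ ha₁.le)
            exact_mod_cast Nat.le_add_right t r
          calc c t * (θ / ((t + r : ℕ) : ℝ)) ≤ (a₁ * ((t + r : ℕ) : ℝ)) * (θ / ((t + r : ℕ) : ℝ)) :=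
                mul_le_mul_of_nonneg_right h5 hy0
            _ = a₁ * θ := by field_simp
            _ ≤ a₁ * (a₂ / a₁) := mul_le_mul_of_nonneg_left h4 ha₁.le
            _ = a₂ := by field_simp
        linarith
    have h1 : Real.log (p k * (1 + θ / k)) ≤ ℓ (k + m) :=
      Real.log_le_log (mul_pos (hp0 k) (by linarith)) hpk
    rw [Real.log_mul (hp0 k).ne' (by linarith)] at h1
    have h2 := Real.one_sub_inv_le_log_of_pos (x := 1 + θ / k) (by linarith)
    have h3 : θ / (2 * k) ≤ 1 - (1 + θ / k)⁻¹ := by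
      have e : 1 - (1 + θ / k)⁻¹ = (θ / k) / (1 + θ / k) := by
        have : 1 + θ / (k:ℝ) ≠ 0 := by linarith
        field_simp; ring
      have e2 : θ / (2 * k) = (θ / k) / 2 := by field_simp
      rw [e, e2]
      exact div_le_div_of_nonneg_left hy0 (by linarith) (by linarith)
    have : ℓ k = Real.log (p k) := rfl
    linarith
  have hctlow : ∀ k, 0 < k → ε * k / (r + 1) ≤ ct k := by
    intro k hk
    have hk' : (0:ℝ) < k := by exact_mod_cast hk
    have hpos : 0 < ε * k / (r + 1) := by positivity
    rw [hcts k hk, ← Real.log_le_iff_le_exp hpos]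
    have h1 : ∀ j ∈ Finset.range m, Real.log (ε * k / (r + 1)) ≤ ℓ (k + j) := by
      intro j _
      apply Real.log_le_log hpos
      rw [div_le_iff₀ (by positivity)]
      rcases le_or_gt (k + j) r with h | h
      · rw [hp1 _ h]
        apply mul_le_mul_of_nonneg_left _ hε0.le
        exact_mod_cast (by omega : k ≤ r + 1)
      · obtain ⟨t, ht⟩ : ∃ t, k + j = t + r := ⟨k + j - r, by omega⟩
        have ht0 : 0 < t := by omega
        rw [ht, hp2 t ht0]
        have h2 := hlow t
        have h3 : (k:ℝ) ≤ t * (r + 1) := by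
          have : k ≤ t * (r + 1) := by nlinarith
          exact_mod_cast this
        have h4 : ε * t ≤ c t := by
          refine le_trans ?_ h2
          apply mul_le_mul_of_nonneg_right _ (Nat.cast_nonneg t)
          rw [hε]; linarith
        calc ε * k ≤ ε * (t * (r + 1)) := mul_le_mul_of_nonneg_left h3 hε0.le
          _ = ε * t * (r + 1) := by ring
          _ ≤ _ := mul_le_mul_of_nonneg_right h4 (by positivity)
    have h2 := Finset.sum_le_sum h1
    rw [Finset.sum_const, Finset.card_range, nsmul_eq_mul] at h2
    have h3 := mul_le_mul_of_nonneg_left h2 (by positivity : (0:ℝ) ≤ 1 / m)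
    have e : 1 / (m:ℝ) * (m * Real.log (ε * k / (r + 1))) = Real.log (ε * k / (r + 1)) := by
      field_simp
    linarith
  set δ := min (ct 1) (ε * θ / (2 * m * (r + 1))) with hδ
  have hδ0 : 0 < δ := lt_min (hctpos 1 one_pos) (by positivity)
  have hinc : ∀ k, δ ≤ ct (k + 1) - ct k := by
    intro k
    rcases Nat.eq_zero_or_pos k with rfl | hk
    · rw [hct0, sub_zero, zero_add]; exact min_le_left _ _
    · refine (min_le_right _ _).trans ?_
      have hk' : (0:ℝ) < k := by exact_mod_cast hk
      have e : ct (k + 1) = ct k * Real.exp ((1 / m) * (ℓ (k + m) - ℓ k)) := by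
        rw [hcts k hk, hcts (k + 1) (Nat.succ_pos _), ← Real.exp_add]
        congr 1
        have h1 : ∑ j ∈ Finset.range m, ℓ (k + 1 + j) = ∑ j ∈ Finset.range m, ℓ (k + (j + 1)) :=
          Finset.sum_congr rfl fun j _ => by rw [add_assoc, add_comm 1 j]
        have h2 := Finset.sum_range_succ' (fun j => ℓ (k + j)) m
        have h3 := Finset.sum_range_succ (fun j => ℓ (k + j)) m
        simp only [add_zero] at h2
        rw [h1]
        have : ∑ j ∈ Finset.range m, ℓ (k + (j + 1)) =
          ∑ j ∈ Finset.range m, ℓ (k + j) + (ℓ (k + m) - ℓ k) := by linarith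
        rw [this]; ring
      have h1 := Real.add_one_le_exp ((1 / m) * (ℓ (k + m) - ℓ k))
      have h2 := mul_le_mul_of_nonneg_left h1 (hctpos k hk).le
      have h3 := mul_le_mul_of_nonneg_left (hstep k hk) (by positivity : (0:ℝ) ≤ 1 / m)
      have h4 : ε * k / (r + 1) * (1 / m * (θ / (2 * k))) ≤
          ct k * ((1 / m) * (ℓ (k + m) - ℓ k)) :=
        mul_le_mul (hctlow k hk) h3 (by positivity) (hctpos k hk).le
      have e2 : ε * k / (r + 1) * (1 / m * (θ / (2 * k))) = ε * θ / (2 * m * (r + 1)) := by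
        field_simp
      rw [e]
      linarith
  -- comparison of factorials
  set P : ℕ → ℝ := fun n => ∑ i ∈ Finset.range (n + 1), ℓ i with hP
  have hPs : ∀ n, P (n + 1) = P n + ℓ (n + 1) := fun n => Finset.sum_range_succ _ _
  have hPe : ∀ n j, |P (n + j) - P n - j * ℓ n| ≤ B * (j : ℝ) ^ 2 := by
    intro n j
    induction j with
    | zero => simp
    | succ j ih =>
      have e : P (n + (j + 1)) - P n - ((j + 1 : ℕ) : ℝ) * ℓ n =
        (P (n + j) - P n - j * ℓ n) + (ℓ (n + (j + 1)) - ℓ n) := by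
        rw [← add_assoc, hPs]; push_cast; ring
      rw [e]
      refine (abs_add_le _ _).trans ?_
      have := hℓj n (j + 1)
      push_cast at this ⊢
      nlinarith [mul_nonneg hB0.le (Nat.cast_nonneg (α := ℝ) j)]
  set H : ℕ → ℝ := fun n => (1 / m) * ∑ j ∈ Finset.range m, P (n + j) with hH
  have hd : ∀ n, Real.log (cfact ct n) - Real.log (cfact c n) =
      (H n - P (n + r)) - (H 0 - P (0 + r)) := by
    intro n
    induction n with
    | zero => simp [cfact]
    | succ n ih =>
      simp only [cfact]
      rw [Real.log_mul (cfact_pos hctpos n).ne' (hctpos _ (Nat.succ_pos n)).ne',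
        Real.log_mul (cfact_pos hcpos n).ne' (hcpos _ (Nat.succ_pos n)).ne',
        hcts (n + 1) (Nat.succ_pos n), Real.log_exp]
      have e1 : H (n + 1) = H n + 1 / m * ∑ j ∈ Finset.range m, ℓ (n + 1 + j) := by
        simp only [hH]
        rw [← mul_add, ← Finset.sum_add_distrib]
        congr 1
        apply Finset.sum_congr rfl; intro j _
        rw [show n + 1 + j = (n + j) + 1 by ring, hPs]
      have e2 : P (n + 1 + r) = P (n + r) + Real.log (c (n + 1)) := by
        rw [show n + 1 + r = (n + r) + 1 by ring, hPs, show n + r + 1 = (n + 1) + r by ring]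
        simp only [hℓ]; rw [hp2 (n + 1) (Nat.succ_pos n)]
      rw [e1, e2]; linarith
  have hHb : ∀ n, |H n - P (n + r)| ≤ 2 * B * (m:ℝ) ^ 2 := by
    intro n
    have hsum : ∑ j ∈ Finset.range m, (j : ℝ) = m * r := by
      have h1 := Finset.sum_range_id_mul_two m
      have h2 : (∑ j ∈ Finset.range m, j) = m * r := by
        have : m - 1 = 2 * r := by omega
        rw [this] at h1; nlinarith
      rw [← Nat.cast_sum, h2]; push_cast; ring
    have e : H n - P (n + r) = 1 / m * ∑ j ∈ Finset.range m, (P (n + j) - P n - j * ℓ n)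
        - (P (n + r) - P n - r * ℓ n) := by
      simp only [hH]
      rw [Finset.sum_sub_distrib, Finset.sum_sub_distrib, ← Finset.sum_mul, hsum,
        Finset.sum_const, Finset.card_range, nsmul_eq_mul]
      field_simp; ring
    have h1 : |∑ j ∈ Finset.range m, (P (n + j) - P n - j * ℓ n)| ≤ m * (B * (m:ℝ) ^ 2) := by
      refine (Finset.abs_sum_le_sum_abs _ _).trans ?_
      have : ∀ j ∈ Finset.range m, |P (n + j) - P n - j * ℓ n| ≤ B * (m:ℝ) ^ 2 := by
        intro j hj
        refine (hPe n j).trans (mul_le_mul_of_nonneg_left ?_ hB0.le)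
        have : (j:ℝ) ≤ m := by exact_mod_cast (Finset.mem_range.1 hj).le
        gcongr
      refine (Finset.sum_le_sum this).trans (le_of_eq ?_)
      rw [Finset.sum_const, Finset.card_range, nsmul_eq_mul]
    have h2 : |P (n + r) - P n - r * ℓ n| ≤ B * (m:ℝ) ^ 2 := by
      refine (hPe n r).trans (mul_le_mul_of_nonneg_left ?_ hB0.le)
      have : (r:ℝ) ≤ m := by exact_mod_cast (by omega : r ≤ m)
      gcongr
    rw [e]
    refine (abs_sub _ _).trans ?_
    rw [abs_mul, abs_of_pos (by positivity : (0:ℝ) < 1 / m)]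
    have h3 := mul_le_mul_of_nonneg_left h1 (by positivity : (0:ℝ) ≤ 1 / m)
    have e3 : 1 / (m:ℝ) * (m * (B * (m:ℝ) ^ 2)) = B * (m:ℝ) ^ 2 := by field_simp
    linarith
  have hlog : ∀ n, |Real.log (cfact ct n) - Real.log (cfact c n)| ≤ 4 * B * (m:ℝ) ^ 2 := by
    intro n
    rw [hd]
    refine (abs_sub _ _).trans ?_
    linarith [hHb n, hHb 0]
  refine ⟨ct, δ, Real.exp (4 * B * (m:ℝ) ^ 2), hct0, hctpos, hδ0, hinc, Real.exp_pos _, fun n => ?_⟩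
  have h := abs_le.1 (hlog n)
  constructor
  · rw [← Real.exp_log (cfact_pos hctpos n), ← Real.exp_log (cfact_pos hcpos n), ← Real.exp_add]
    apply Real.exp_le_exp.2
    linarith [h.2]
  · rw [← Real.exp_log (cfact_pos hctpos n), ← Real.exp_log (cfact_pos hcpos n), ← Real.exp_add]
    apply Real.exp_le_exp.2
    linarith [h.1]

lemma wt_cmp {c d : ℕ → ℝ} (hc : ∀ n : ℕ, 0 < n → 0 < c n) (hd : ∀ n : ℕ, 0 < n → 0 < d n)
    {b : ℝ} (h : ∀ n, cfact c n ≤ b * cfact d n) (Λ : Finset ℤ) (η : ℤ → ℕ) :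
    wt d Λ η ≤ b ^ Λ.card * wt c Λ η := by
  unfold wt
  rw [← Finset.prod_const, ← Finset.prod_mul_distrib]
  apply Finset.prod_le_prod
  · intro x _; exact (inv_pos.2 (cfact_pos hd _)).le
  · intro x _
    have h1 := cfact_pos hc (η x)
    have h2 := cfact_pos hd (η x)
    rw [← div_eq_mul_inv, le_div_iff₀ h1, inv_mul_le_iff₀ h2]
    linarith [h (η x)]

/-- spectral gap, uniformly in the number of particles -/
lemma gap {c : ℕ → ℝ} {a₁ a₂ δ₁ : ℝ} {k₀ : ℕ} (hc0 : c 0 = 0)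
    (hcpos : ∀ n : ℕ, 0 < n → 0 < c n) (hLG : ∀ k : ℕ, |c (k + 1) - c k| ≤ a₁) (ha₂ : 0 < a₂)
    (hM : ∀ j k : ℕ, j + k₀ ≤ k → a₂ ≤ c k - c j) (hδ₁ : 0 < δ₁) (hlow : ∀ n : ℕ, δ₁ * n ≤ c n)
    (K : ℕ) (hK : 0 < K) :
    ∃ C : ℝ, 0 < C ∧ ∀ Λ : Finset ℤ, Λ.card = K → ∀ (M : ℕ) (f : (ℤ → ℕ) → ℝ),
      ∃ a : ℝ, ∑ η ∈ S Λ (M + 1), wt c Λ η * (f η - a) ^ 2 ≤ C * DF c Λ M f := by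
  obtain ⟨ct, δ, b, h0, hpos, hδ, hinc, hb, hcmp⟩ := exists_ct hc0 hcpos hLG ha₂ hM hδ₁ hlow
  have hK' : (0:ℝ) < K := by exact_mod_cast hK
  refine ⟨b ^ K * b ^ K / (2 * δ * K), by positivity, fun Λ hΛ M f => ?_⟩
  have hne : Λ.Nonempty := Finset.card_pos.1 (by omega)
  obtain ⟨a, ha⟩ := gap0 h0 hpos hδ hinc hne M f
  refine ⟨a, ?_⟩
  rw [hΛ] at ha
  have h1 : ∑ η ∈ S Λ (M + 1), wt c Λ η * (f η - a) ^ 2 ≤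
      b ^ K * ∑ η ∈ S Λ (M + 1), wt ct Λ η * (f η - a) ^ 2 := by
    rw [Finset.mul_sum]
    apply Finset.sum_le_sum; intro η _
    rw [← mul_assoc]
    apply mul_le_mul_of_nonneg_right _ (sq_nonneg _)
    have := wt_cmp hpos hcpos (fun n => (hcmp n).1) Λ η
    rwa [hΛ] at this
  have h2 : DF ct Λ M f ≤ b ^ K * DF c Λ M f := by
    unfold DF
    rw [Finset.mul_sum]
    apply Finset.sum_le_sum; intro η _
    rw [← mul_assoc]
    apply mul_le_mul_of_nonneg_right _
      (Finset.sum_nonneg fun _ _ => Finset.sum_nonneg fun _ _ => sq_nonneg _)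
    have := wt_cmp hcpos hpos (fun n => (hcmp n).2) Λ η
    rwa [hΛ] at this
  rw [div_mul_eq_mul_div, le_div_iff₀ (by positivity)]
  have h3 := mul_le_mul_of_nonneg_left (ha.trans h2) (by positivity : 0 ≤ b ^ K)
  have h4 := mul_le_mul_of_nonneg_right h1 (by positivity : 0 ≤ 2 * δ * K)
  linarith

end ZR

namespace ZR

lemma stepB_pt {A B P Q a ε : ℝ} (ha : 0 < a) (hε : 0 < ε) (h : |P - Q| ≤ 2 * a) :
    A ^ 2 * P - B ^ 2 * Q ≤ a * (A ^ 2 + B ^ 2) + 1 / (4 * ε) * (A - B) ^ 2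
      + ε * (4 * (A ^ 2 * P ^ 2 + B ^ 2 * Q ^ 2) + 4 * a ^ 2 * (A ^ 2 + B ^ 2)) := by
  have h1 := abs_le.1 h
  have hPQ : (P - Q) ^ 2 ≤ 4 * a ^ 2 := by nlinarith
  have e : A ^ 2 * P - B ^ 2 * Q = (A ^ 2 + B ^ 2) * (P - Q) / 2 + (A - B) * ((A + B) * (P + Q) / 2) := by
    ring
  have e1 : (A ^ 2 + B ^ 2) * (P - Q) / 2 ≤ a * (A ^ 2 + B ^ 2) := by
    nlinarith [sq_nonneg A, sq_nonneg B]
  have e2 : (A - B) * ((A + B) * (P + Q) / 2) ≤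
      1 / (4 * ε) * (A - B) ^ 2 + ε * ((A + B) * (P + Q) / 2) ^ 2 := by
    have : 1 / (4 * ε) * (A - B) ^ 2 + ε * ((A + B) * (P + Q) / 2) ^ 2 - (A - B) * ((A + B) * (P + Q) / 2)
      = ε * ((A + B) * (P + Q) / 2 - (A - B) / (2 * ε)) ^ 2 := by field_simp; ring
    have h2 : 0 ≤ ε * ((A + B) * (P + Q) / 2 - (A - B) / (2 * ε)) ^ 2 := by positivity
    linarith
  have e3 : ((A + B) * (P + Q) / 2) ^ 2 ≤
      4 * (A ^ 2 * P ^ 2 + B ^ 2 * Q ^ 2) + 4 * a ^ 2 * (A ^ 2 + B ^ 2) := by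
    have f1 : (A + B) ^ 2 ≤ 2 * (A ^ 2 + B ^ 2) := by nlinarith [sq_nonneg (A - B)]
    have f2 : (P + Q) ^ 2 ≤ 8 * P ^ 2 + 8 * a ^ 2 := by nlinarith [sq_nonneg (3 * P - Q)]
    have f3 : (P + Q) ^ 2 ≤ 8 * Q ^ 2 + 8 * a ^ 2 := by nlinarith [sq_nonneg (3 * Q - P)]
    have f4 := mul_le_mul_of_nonneg_right f1 (sq_nonneg (P + Q))
    have f5 := mul_le_mul_of_nonneg_left f2 (sq_nonneg A)
    have f6 := mul_le_mul_of_nonneg_left f3 (sq_nonneg B)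
    have : ((A + B) * (P + Q) / 2) ^ 2 = (A + B) ^ 2 * (P + Q) ^ 2 / 4 := by ring
    rw [this]; nlinarith
  have e4 := mul_le_mul_of_nonneg_left e3 hε.le
  linarith

lemma delta_bd {c : ℕ → ℝ} {a₁ : ℝ} (hLG : ∀ k : ℕ, |c (k + 1) - c k| ≤ a₁) (ξ : ℤ → ℕ) (x y : ℤ) :
    |(c (ad ξ x x) - c (ad ξ x y)) - (c (ad ξ y x) - c (ad ξ y y))| ≤ 2 * a₁ := by
  have ha₁ : 0 ≤ a₁ := (abs_nonneg _).trans (hLG 0)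
  by_cases h : x = y
  · subst h; simp [ha₁]
  · rw [ad_self, ad_self, ad_ne _ h, ad_ne _ (Ne.symm h)]
    have h1 := abs_le.1 (hLG (ξ x)); have h2 := abs_le.1 (hLG (ξ y))
    rw [abs_le]; constructor <;> linarith [h1.1, h1.2, h2.1, h2.2]

lemma stepB_xy {c : ℕ → ℝ} {a₁ : ℝ} (hc0 : c 0 = 0)
    (hc : ∀ n : ℕ, 0 < n → 0 < c n) (hLG : ∀ k : ℕ, |c (k + 1) - c k| ≤ a₁) (ha₁ : 0 < a₁)
    {Λ : Finset ℤ} {x y : ℤ} (hx : x ∈ Λ) (hy : y ∈ Λ) (M : ℕ) (g : (ℤ → ℕ) → ℝ) :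
    ∑ η ∈ S Λ (M + 1), wt c Λ η * (g η ^ 2 * (c (η x) - c (η y)) ^ 2) ≤
      ((M + 1 : ℕ) : ℝ) * (5 * a₁ ^ 2 * ∑ η ∈ S Λ (M + 1), wt c Λ η * g η ^ 2 +
        8 * a₁ * DF c Λ M g) := by
  set N : ℝ := ((M + 1 : ℕ) : ℝ) with hN
  have hN1 : 1 ≤ N := by rw [hN]; push_cast; linarith [(Nat.cast_nonneg M : (0:ℝ) ≤ M)]
  set X := ∑ η ∈ S Λ (M + 1), wt c Λ η * g η ^ 2 with hX
  set T := ∑ η ∈ S Λ (M + 1), wt c Λ η * (g η ^ 2 * (c (η x) - c (η y)) ^ 2) with hT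
  have hX0 : 0 ≤ X := Finset.sum_nonneg fun η _ => mul_nonneg (wt_pos hc _ _).le (sq_nonneg _)
  have back : ∀ z ∈ Λ, ∀ F : (ℤ → ℕ) → ℝ, (∀ η, 0 ≤ F η) →
      ∑ ξ ∈ S Λ M, wt c Λ ξ * F (ad ξ z) ≤ a₁ * N * ∑ η ∈ S Λ (M + 1), wt c Λ η * F η := by
    intro z hz F hF
    rw [← ibp hc0 hc hz M F, Finset.mul_sum]
    apply Finset.sum_le_sum; intro η hη
    have h1 : c (η z) ≤ a₁ * N := by
      refine (c_upper hc0 hLG _).trans (mul_le_mul_of_nonneg_left ?_ ha₁.le)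
      rw [hN]; exact_mod_cast le_of_mem hz hη
    have := mul_le_mul_of_nonneg_right h1 (mul_nonneg (wt_pos hc Λ η).le (hF η))
    linarith
  set D := ∑ ξ ∈ S Λ M, wt c Λ ξ * (g (ad ξ x) - g (ad ξ y)) ^ 2 with hD
  have hDF : D ≤ DF c Λ M g := by
    apply Finset.sum_le_sum; intro ξ _
    apply mul_le_mul_of_nonneg_left _ (wt_pos hc Λ ξ).le
    refine le_trans ?_ (Finset.single_le_sum (f := fun x => ∑ y ∈ Λ, (g (ad ξ y) - g (ad ξ x)) ^ 2)
      (fun _ _ => Finset.sum_nonneg fun _ _ => sq_nonneg _) hy)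
    exact Finset.single_le_sum (f := fun x => (g (ad ξ x) - g (ad ξ y)) ^ 2)
      (fun _ _ => sq_nonneg _) hx
  set ε : ℝ := 1 / (16 * a₁ * N) with hε
  have hε0 : 0 < ε := by positivity
  set H : (ℤ → ℕ) → ℝ := fun η => g η ^ 2 * (c (η x) - c (η y)) with hH
  have e1 : T = ∑ ξ ∈ S Λ M, wt c Λ ξ * (H (ad ξ x) - H (ad ξ y)) := by
    have : T = ∑ η ∈ S Λ (M + 1), wt c Λ η * (c (η x) * H η) -
        ∑ η ∈ S Λ (M + 1), wt c Λ η * (c (η y) * H η) := by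
      rw [← Finset.sum_sub_distrib]
      exact Finset.sum_congr rfl fun η _ => by simp only [hH]; ring
    rw [this, ibp hc0 hc hx, ibp hc0 hc hy, ← Finset.sum_sub_distrib]
    exact Finset.sum_congr rfl fun η _ => by ring
  set G2 : (ℤ → ℕ) → ℝ := fun η => g η ^ 2
  set G3 : (ℤ → ℕ) → ℝ := fun η => g η ^ 2 * (c (η x) - c (η y)) ^ 2
  have b1 := back x hx G2 (fun η => sq_nonneg _)
  have b2 := back y hy G2 (fun η => sq_nonneg _)
  have b3 := back x hx G3 (fun η => mul_nonneg (sq_nonneg _) (sq_nonneg _))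
  have b4 := back y hy G3 (fun η => mul_nonneg (sq_nonneg _) (sq_nonneg _))
  have e2 : T ≤ (a₁ + ε * (4 * a₁ ^ 2)) * (∑ ξ ∈ S Λ M, wt c Λ ξ * G2 (ad ξ x) +
      ∑ ξ ∈ S Λ M, wt c Λ ξ * G2 (ad ξ y)) + 1 / (4 * ε) * D +
      4 * ε * (∑ ξ ∈ S Λ M, wt c Λ ξ * G3 (ad ξ x) + ∑ ξ ∈ S Λ M, wt c Λ ξ * G3 (ad ξ y)) := by
    rw [e1, hD, ← Finset.sum_add_distrib, ← Finset.sum_add_distrib, Finset.mul_sum, Finset.mul_sum,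
      Finset.mul_sum, ← Finset.sum_add_distrib, ← Finset.sum_add_distrib]
    apply Finset.sum_le_sum; intro ξ _
    have := stepB_pt (A := g (ad ξ x)) (B := g (ad ξ y)) ha₁ hε0 (delta_bd hLG ξ x y)
    have := mul_le_mul_of_nonneg_left this (wt_pos hc Λ ξ).le
    refine this.trans (le_of_eq ?_)
    simp only [G2, G3]; ring
  have b1' : ∑ ξ ∈ S Λ M, wt c Λ ξ * G2 (ad ξ x) ≤ a₁ * N * X := b1
  have b2' : ∑ ξ ∈ S Λ M, wt c Λ ξ * G2 (ad ξ y) ≤ a₁ * N * X := b2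
  have b3' : ∑ ξ ∈ S Λ M, wt c Λ ξ * G3 (ad ξ x) ≤ a₁ * N * T := b3
  have b4' : ∑ ξ ∈ S Λ M, wt c Λ ξ * G3 (ad ξ y) ≤ a₁ * N * T := b4
  have e3 : T ≤ (a₁ + ε * (4 * a₁ ^ 2)) * (2 * (a₁ * N * X)) + 1 / (4 * ε) * DF c Λ M g +
      4 * ε * (2 * (a₁ * N * T)) := by
    refine e2.trans ?_
    gcongr <;> linarith
  have e4 : 4 * ε * (2 * (a₁ * N * T)) = T / 2 := by rw [hε]; field_simp; ring
  have e5 : ε * (4 * a₁ ^ 2) * (2 * (a₁ * N * X)) = a₁ ^ 2 * X / 2 := by rw [hε]; field_simp; ring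
  have e6 : 1 / (4 * ε) = 4 * a₁ * N := by rw [hε]; field_simp; ring
  rw [e4, e6, add_mul, e5] at e3
  have e7 : a₁ ^ 2 * X ≤ N * (a₁ ^ 2 * X) := le_mul_of_one_le_left (by positivity) hN1
  nlinarith

/-- normalised fluctuation -/
def WW (Λ : Finset ℤ) (N : ℕ) (η : ℤ → ℕ) : ℝ :=
  (∑ x ∈ Λ, ((η x : ℝ) - (N : ℝ) / Λ.card) ^ 2) / N

lemma WW_nonneg (Λ : Finset ℤ) (N : ℕ) (η : ℤ → ℕ) : 0 ≤ WW Λ N η :=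
  div_nonneg (Finset.sum_nonneg fun _ _ => sq_nonneg _) (Nat.cast_nonneg _)

lemma stepB {c : ℕ → ℝ} {a₁ B : ℝ} (hc0 : c 0 = 0)
    (hc : ∀ n : ℕ, 0 < n → 0 < c n) (hLG : ∀ k : ℕ, |c (k + 1) - c k| ≤ a₁) (ha₁ : 0 < a₁)
    (hB0 : 0 < B) (hB : ∀ m n : ℕ, |(m : ℝ) - n| ≤ B * (|c m - c n| + 1)) (K : ℕ) (hK : 0 < K) :
    ∃ C : ℝ, 0 < C ∧ ∀ Λ : Finset ℤ, Λ.card = K → ∀ (M : ℕ) (h : (ℤ → ℕ) → ℝ),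
      ∑ η ∈ S Λ (M + 1), wt c Λ η * (h η ^ 2 * (1 + WW Λ (M + 1) η)) ≤
        C * (DF c Λ M h + ∑ η ∈ S Λ (M + 1), wt c Λ η * h η ^ 2) := by
  have hK' : (0:ℝ) < K := by exact_mod_cast hK
  refine ⟨1 + 2 * B ^ 2 * K * (5 * a₁ ^ 2 + 8 * a₁ + 1), by positivity, fun Λ hΛ M h => ?_⟩
  set N : ℝ := ((M + 1 : ℕ) : ℝ) with hN
  have hN1 : 1 ≤ N := by rw [hN]; push_cast; linarith [(Nat.cast_nonneg M : (0:ℝ) ≤ M)]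
  set X := ∑ η ∈ S Λ (M + 1), wt c Λ η * h η ^ 2 with hX
  have hX0 : 0 ≤ X := Finset.sum_nonneg fun η _ => mul_nonneg (wt_pos hc _ _).le (sq_nonneg _)
  have hD0 := DF_nonneg hc Λ M h
  have pt : ∀ η ∈ S Λ (M + 1), WW Λ (M + 1) η ≤
      2 * B ^ 2 / (K * N) * ∑ x ∈ Λ, ∑ y ∈ Λ, ((c (η x) - c (η y)) ^ 2 + 1) := by
    intro η hη
    have hs : ∑ y ∈ Λ, (η y : ℝ) = N := by
      rw [hN, ← (mem_S.1 hη).1]; push_cast; rfl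
    unfold WW
    rw [← hN, hΛ, div_le_iff₀ (by positivity), Finset.mul_sum, Finset.sum_mul]
    apply Finset.sum_le_sum; intro x hx
    have e : (η x : ℝ) - N / K = (∑ y ∈ Λ, ((η x : ℝ) - η y)) / K := by
      rw [Finset.sum_sub_distrib, hs, Finset.sum_const, hΛ, nsmul_eq_mul]; field_simp
    rw [e]
    have cs := sq_sum_le_card_mul_sum_sq (s := Λ) (f := fun y => (η x : ℝ) - η y)
    rw [hΛ] at cs
    have h2 : ∑ y ∈ Λ, ((η x : ℝ) - η y) ^ 2 ≤
        ∑ y ∈ Λ, 2 * B ^ 2 * ((c (η x) - c (η y)) ^ 2 + 1) := by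
      apply Finset.sum_le_sum; intro y _
      have h3 := hB (η x) (η y)
      have h4 : ((η x : ℝ) - η y) ^ 2 ≤ (B * (|c (η x) - c (η y)| + 1)) ^ 2 := by
        rw [← sq_abs]; exact pow_le_pow_left₀ (abs_nonneg _) h3 2
      refine h4.trans ?_
      rw [← sq_abs (c (η x) - c (η y))]
      nlinarith [mul_nonneg (sq_nonneg B) (sq_nonneg (|c (η x) - c (η y)| - 1))]
    rw [← Finset.mul_sum] at h2
    rw [div_pow, div_le_iff₀ (by positivity)]
    refine cs.trans ((mul_le_mul_of_nonneg_left h2 hK'.le).trans (le_of_eq ?_))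
    field_simp
  have main : ∑ η ∈ S Λ (M + 1), wt c Λ η * (h η ^ 2 * WW Λ (M + 1) η) ≤
      2 * B ^ 2 / (K * N) * ∑ x ∈ Λ, ∑ y ∈ Λ, (N * (5 * a₁ ^ 2 * X + 8 * a₁ * DF c Λ M h) + X) := by
    have h1 : ∑ η ∈ S Λ (M + 1), wt c Λ η * (h η ^ 2 * WW Λ (M + 1) η) ≤
        ∑ η ∈ S Λ (M + 1), 2 * B ^ 2 / (K * N) * ∑ x ∈ Λ, ∑ y ∈ Λ,
          (wt c Λ η * (h η ^ 2 * (c (η x) - c (η y)) ^ 2) + wt c Λ η * h η ^ 2) := by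
      apply Finset.sum_le_sum; intro η hη
      have := mul_le_mul_of_nonneg_left (pt η hη) (mul_nonneg (wt_pos hc Λ η).le (sq_nonneg (h η)))
      rw [← mul_assoc]
      refine this.trans (le_of_eq ?_)
      simp only [Finset.mul_sum]
      refine Finset.sum_congr rfl fun x _ => Finset.sum_congr rfl fun y _ => by ring
    refine h1.trans ?_
    rw [← Finset.mul_sum, Finset.sum_comm]
    apply mul_le_mul_of_nonneg_left _ (by positivity)
    apply Finset.sum_le_sum; intro x hx
    rw [Finset.sum_comm]
    apply Finset.sum_le_sum; intro y hy
    rw [Finset.sum_add_distrib]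
    have := stepB_xy hc0 hc hLG ha₁ hx hy M h
    linarith
  simp only [Finset.sum_const, hΛ, nsmul_eq_mul] at main
  have e2 : 2 * B ^ 2 / (K * N) * (K * (K * (N * (5 * a₁ ^ 2 * X + 8 * a₁ * DF c Λ M h) + X))) =
      2 * B ^ 2 * K * (5 * a₁ ^ 2 * X + 8 * a₁ * DF c Λ M h + X / N) := by
    field_simp
  rw [e2] at main
  have e3 : X / N ≤ X := div_le_self hX0 hN1
  have e4 : ∑ η ∈ S Λ (M + 1), wt c Λ η * (h η ^ 2 * (1 + WW Λ (M + 1) η)) =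
      X + ∑ η ∈ S Λ (M + 1), wt c Λ η * (h η ^ 2 * WW Λ (M + 1) η) := by
    rw [hX, ← Finset.sum_add_distrib]
    exact Finset.sum_congr rfl fun η _ => by ring
  rw [e4]
  have e5 : 2 * B ^ 2 * K * (5 * a₁ ^ 2 * X + 8 * a₁ * DF c Λ M h + X / N) ≤
      2 * B ^ 2 * K * ((5 * a₁ ^ 2 + 8 * a₁ + 1) * (DF c Λ M h + X)) := by
    apply mul_le_mul_of_nonneg_left _ (by positivity)
    have : 0 ≤ 5 * a₁ ^ 2 * DF c Λ M h := by positivity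
    have : 0 ≤ 8 * a₁ * X := by positivity
    nlinarith
  nlinarith

/-- ground state transform for the entropy -/
lemma gst {α : Type*} (s : Finset α) (w w1 R h V : α → ℝ) (hw1 : ∀ a ∈ s, 0 < w1 a)
    (hw : ∀ a ∈ s, w a = w1 a * Real.exp (R a)) (hs : s.Nonempty) {κ C C2 : ℝ} (hC : 0 ≤ C)
    (hR : ∀ a ∈ s, |R a - κ| ≤ C * V a) (hV : ∑ a ∈ s, w a * V a ≤ C2 * ∑ a ∈ s, w a) :
    uent s w (fun a => h a ^ 2) ≤ uent s w1 (fun a => (h a * Real.exp (R a / 2)) ^ 2) +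
      C * ∑ a ∈ s, w a * (h a ^ 2 * V a) + C * C2 * ∑ a ∈ s, w a * h a ^ 2 := by
  have hwp : ∀ a ∈ s, 0 < w a := fun a ha => by
    rw [hw a ha]; exact mul_pos (hw1 a ha) (Real.exp_pos _)
  set Z := ∑ a ∈ s, w a with hZ
  set Z1 := ∑ a ∈ s, w1 a with hZ1
  have hZ0 : 0 < Z := Finset.sum_pos hwp hs
  have hZ10 : 0 < Z1 := Finset.sum_pos hw1 hs
  set X := ∑ a ∈ s, w a * h a ^ 2 with hX
  have hX0 : 0 ≤ X := Finset.sum_nonneg fun a ha => mul_nonneg (hwp a ha).le (sq_nonneg _)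
  have hsq : ∀ a, (h a * Real.exp (R a / 2)) ^ 2 = h a ^ 2 * Real.exp (R a) := by
    intro a
    rw [mul_pow, ← Real.exp_nat_mul]; congr 2; push_cast; ring
  have eX : ∑ a ∈ s, w1 a * (h a * Real.exp (R a / 2)) ^ 2 = X := by
    rw [hX]; exact Finset.sum_congr rfl fun a ha => by rw [hsq, hw a ha]; ring
  have eL : ∑ a ∈ s, w1 a * ((h a * Real.exp (R a / 2)) ^ 2 *
      Real.log ((h a * Real.exp (R a / 2)) ^ 2)) =
      ∑ a ∈ s, w a * (h a ^ 2 * Real.log (h a ^ 2)) + ∑ a ∈ s, w a * (h a ^ 2 * R a) := by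
    rw [← Finset.sum_add_distrib]
    refine Finset.sum_congr rfl fun a ha => ?_
    rw [hsq, hw a ha]
    by_cases h0 : h a = 0
    · simp [h0]
    · rw [Real.log_mul (pow_ne_zero 2 h0) (Real.exp_pos _).ne', Real.log_exp]; ring
  -- Jensen
  have jen : Real.log Z - Real.log Z1 ≤ κ + C * C2 := by
    set r := (∑ a ∈ s, w a * R a) / Z with hr
    have h1 : Real.exp (-r) * Z ≤ Z1 := by
      have : ∀ a ∈ s, Real.exp (-r) * (w a * (1 - (R a - r))) ≤ w1 a := by
        intro a ha
        have e := Real.add_one_le_exp (-(R a - r))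
        have e2 : w1 a = Real.exp (-r) * (w a * Real.exp (-(R a - r))) := by
          rw [hw a ha]
          have : Real.exp (-r) * (w1 a * Real.exp (R a) * Real.exp (-(R a - r))) =
            w1 a * (Real.exp (-r) * Real.exp (R a) * Real.exp (-(R a - r))) := by ring
          rw [this, ← Real.exp_add, ← Real.exp_add]
          have : -r + R a + -(R a - r) = 0 := by ring
          rw [this, Real.exp_zero, mul_one]
        rw [e2]
        apply mul_le_mul_of_nonneg_left _ (Real.exp_pos _).le
        apply mul_le_mul_of_nonneg_left _ (hwp a ha).le
        linarith
      have := Finset.sum_le_sum this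
      rw [← Finset.mul_sum] at this
      have e3 : ∑ a ∈ s, w a * (1 - (R a - r)) = Z := by
        have : ∑ a ∈ s, w a * (1 - (R a - r)) = (1 + r) * Z - ∑ a ∈ s, w a * R a := by
          rw [hZ, Finset.mul_sum, ← Finset.sum_sub_distrib]
          exact Finset.sum_congr rfl fun a _ => by ring
        rw [this]
        have : ∑ a ∈ s, w a * R a = r * Z := by rw [hr]; field_simp
        rw [this]; ring
      rwa [e3] at this
    have h2 := Real.log_le_log (mul_pos (Real.exp_pos _) hZ0) h1
    rw [Real.log_mul (Real.exp_pos _).ne' hZ0.ne', Real.log_exp] at h2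
    have h3 : r ≤ κ + C * C2 := by
      rw [hr, div_le_iff₀ hZ0]
      have : ∑ a ∈ s, w a * R a ≤ ∑ a ∈ s, (κ * w a + C * (w a * V a)) := by
        apply Finset.sum_le_sum; intro a ha
        have := (abs_le.1 (hR a ha)).2
        have := mul_le_mul_of_nonneg_left this (hwp a ha).le
        linarith
      rw [Finset.sum_add_distrib, ← Finset.mul_sum, ← Finset.mul_sum, ← hZ] at this
      have := mul_le_mul_of_nonneg_left hV hC
      linarith
    linarith
  have hk : ∑ a ∈ s, w a * (h a ^ 2 * (κ - R a)) ≤ C * ∑ a ∈ s, w a * (h a ^ 2 * V a) := by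
    rw [Finset.mul_sum]
    apply Finset.sum_le_sum; intro a ha
    have := (abs_le.1 (hR a ha)).1
    have := mul_le_mul_of_nonneg_left (by linarith : κ - R a ≤ C * V a)
      (mul_nonneg (hwp a ha).le (sq_nonneg (h a)))
    linarith
  have hk2 : ∑ a ∈ s, w a * (h a ^ 2 * (κ - R a)) = X * κ - ∑ a ∈ s, w a * (h a ^ 2 * R a) := by
    rw [hX, Finset.sum_mul, ← Finset.sum_sub_distrib]
    exact Finset.sum_congr rfl fun a _ => by ring
  unfold uent
  rw [eX, eL, ← hX, ← hZ, ← hZ1]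
  have hj := mul_le_mul_of_nonneg_left jen hX0
  rcases hX0.eq_or_lt with h0 | h0
  · rw [← h0] at hk2 hj ⊢; linarith
  · rw [Real.log_div h0.ne' hZ0.ne', Real.log_div h0.ne' hZ10.ne']
    linarith

end ZR

namespace ZR

/-- log ratio of rates -/
def psi (c : ℕ → ℝ) (n : ℕ) : ℝ := Real.log ((n : ℝ) / c n)

/-- primitive of `psi` -/
def FF (c : ℕ → ℝ) (n : ℕ) : ℝ := ∑ k ∈ Finset.range n, psi c (k + 1)

/-- log density -/
def RR (c : ℕ → ℝ) (Λ : Finset ℤ) (η : ℤ → ℕ) : ℝ := ∑ x ∈ Λ, FF c (η x)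

lemma FF_succ (c : ℕ → ℝ) (n : ℕ) : FF c (n + 1) = FF c n + psi c (n + 1) :=
  Finset.sum_range_succ _ _

lemma exp_FF {c : ℕ → ℝ} (hc : ∀ n : ℕ, 0 < n → 0 < c n) (n : ℕ) :
    (cfact cid n)⁻¹ * Real.exp (FF c n) = (cfact c n)⁻¹ := by
  induction n with
  | zero => simp [cfact, FF]
  | succ n ih =>
    have h1 : (0:ℝ) < ((n + 1 : ℕ) : ℝ) := by positivity
    have h2 := hc (n + 1) (Nat.succ_pos _)
    rw [FF_succ, Real.exp_add, psi, Real.exp_log (div_pos h1 h2)]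
    simp only [cfact]
    rw [mul_inv, mul_inv, ← ih]
    have : cid (n + 1) = ((n + 1 : ℕ) : ℝ) := rfl
    rw [this]
    have h3 := (cfact_pos cidpos n).ne'
    field_simp

lemma wt_RR {c : ℕ → ℝ} (hc : ∀ n : ℕ, 0 < n → 0 < c n) (Λ : Finset ℤ) (η : ℤ → ℕ) :
    wt c Λ η = wt cid Λ η * Real.exp (RR c Λ η) := by
  unfold wt RR
  rw [Real.exp_sum, ← Finset.prod_mul_distrib]
  exact Finset.prod_congr rfl fun x _ => (exp_FF hc _).symm

lemma RR_ad (c : ℕ → ℝ) {Λ : Finset ℤ} {x : ℤ} (hx : x ∈ Λ) (ξ : ℤ → ℕ) :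
    RR c Λ (ad ξ x) = RR c Λ ξ + psi c (ξ x + 1) := by
  unfold RR
  rw [← Finset.add_sum_erase Λ _ hx, ← Finset.add_sum_erase Λ (fun z => FF c (ξ z)) hx, ad_self,
    FF_succ]
  have : ∑ z ∈ Λ.erase x, FF c (ad ξ x z) = ∑ z ∈ Λ.erase x, FF c (ξ z) :=
    Finset.sum_congr rfl fun z hz => by rw [ad_ne _ (Finset.ne_of_mem_erase hz)]
  rw [this]; ring

section pt
variable {c : ℕ → ℝ} {a₁ δ₁ : ℝ}

lemma psi_lip (hc0 : c 0 = 0) (hc : ∀ n : ℕ, 0 < n → 0 < c n)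
    (hLG : ∀ k : ℕ, |c (k + 1) - c k| ≤ a₁) (ha₁ : 0 < a₁) (hδ : 0 < δ₁)
    (hlow : ∀ n : ℕ, δ₁ * n ≤ c n) {m n : ℕ} (hm : 0 < m) (hn : 0 < n) :
    |psi c m - psi c n| * m ≤ 2 * a₁ / δ₁ * |(m : ℝ) - n| := by
  have hm' : (0:ℝ) < m := by exact_mod_cast hm
  have hn' : (0:ℝ) < n := by exact_mod_cast hn
  have e : ∀ k : ℕ, psi c k = - Real.log (c k / k) := by
    intro k; rw [psi, ← Real.log_inv, inv_div]
  have hb : |c m / m - c n / n| ≤ 2 * a₁ * |(m : ℝ) - n| / m := by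
    rw [le_div_iff₀ hm']
    have : |c m / m - c n / n| * m = |(c m - c n) - c n / n * (m - n)| := by
      rw [← abs_of_pos hm', ← abs_mul, abs_of_pos hm']; congr 1; field_simp; ring
    rw [this]
    refine (abs_sub _ _).trans ?_
    rw [abs_mul, abs_of_pos (div_pos (hc n hn) hn')]
    have h1 := c_lip' hLG m n
    have h2 : c n / n ≤ a₁ := by rw [div_le_iff₀ hn']; exact c_upper hc0 hLG n
    have h3 := mul_le_mul_of_nonneg_right h2 (abs_nonneg ((m:ℝ) - n))
    linarith
  have h1 := log_lip hδ ((le_div_iff₀ hm').2 (hlow m)) ((le_div_iff₀ hn').2 (hlow n)) hb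
  rw [e, e, ← abs_neg]
  have e2 : -(-Real.log (c m / m) - -Real.log (c n / n)) = Real.log (c m / m) - Real.log (c n / n) := by
    ring
  rw [e2]
  have h2 := mul_le_mul_of_nonneg_right h1 hm'.le
  refine h2.trans (le_of_eq ?_)
  field_simp

lemma psi_le (hc : ∀ n : ℕ, 0 < n → 0 < c n) (hδ : 0 < δ₁)
    (hlow : ∀ n : ℕ, δ₁ * n ≤ c n) {m : ℕ} (hm : 0 < m) : Real.exp (psi c m) ≤ 1 / δ₁ := by
  have hm' : (0:ℝ) < m := by exact_mod_cast hm
  rw [psi, Real.exp_log (div_pos hm' (hc m hm)), div_le_div_iff₀ (hc m hm) hδ]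
  linarith [hlow m]

lemma exp_sub_sq {s t E : ℝ} (hs : Real.exp s ≤ E) (ht : Real.exp t ≤ E) :
    (Real.exp (s / 2) - Real.exp (t / 2)) ^ 2 ≤ E * |s - t| ^ 2 := by
  have key : ∀ s t : ℝ, Real.exp s ≤ E → Real.exp t ≤ E → t ≤ s →
      (Real.exp (s / 2) - Real.exp (t / 2)) ^ 2 ≤ E * |s - t| ^ 2 := by
    intro s t hs ht hst
    have h1 : Real.exp (t / 2) ≤ Real.exp (s / 2) := Real.exp_le_exp.2 (by linarith)
    have h2 := Real.add_one_le_exp ((t - s) / 2)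
    have h3 : Real.exp (t / 2) = Real.exp (s / 2) * Real.exp ((t - s) / 2) := by
      rw [← Real.exp_add]; congr 1; ring
    have h4 : Real.exp (s / 2) - Real.exp (t / 2) ≤ Real.exp (s / 2) * (s - t) := by
      rw [h3]
      have := mul_le_mul_of_nonneg_left h2 (Real.exp_pos (s / 2)).le
      nlinarith [mul_nonneg (Real.exp_pos (s / 2)).le (sub_nonneg.2 hst)]
    have h5 := pow_le_pow_left₀ (sub_nonneg.2 h1) h4 2
    have h6 : Real.exp (s / 2) ^ 2 = Real.exp s := by
      rw [← Real.exp_nat_mul]; congr 1; push_cast; ring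
    rw [mul_pow, h6] at h5
    rw [sq_abs]
    exact h5.trans (mul_le_mul_of_nonneg_right hs (sq_nonneg _))
  rcases le_total t s with h | h
  · exact key s t hs ht h
  · have := key t s ht hs h
    rw [abs_sub_comm]
    nlinarith

lemma FF_taylor {C : ℝ} (hC : 0 ≤ C)
    (hlip : ∀ m n : ℕ, 0 < m → 0 < n → |psi c m - psi c n| * m ≤ C * |(m : ℝ) - n|)
    {s : ℕ} (hs : 0 < s) (n : ℕ) :
    |FF c n - FF c s - psi c s * ((n : ℝ) - s)| ≤ C * ((n : ℝ) - s) ^ 2 / s := by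
  have hs' : (0:ℝ) < s := by exact_mod_cast hs
  rw [le_div_iff₀ hs']
  rcases le_total s n with h | h
  · obtain ⟨j, rfl⟩ := Nat.exists_eq_add_of_le h
    clear h
    induction j with
    | zero => simp
    | succ j ih =>
      have e : FF c (s + (j + 1)) - FF c s - psi c s * (((s + (j + 1) : ℕ) : ℝ) - s) =
          (FF c (s + j) - FF c s - psi c s * (((s + j : ℕ) : ℝ) - s)) +
            (psi c (s + j + 1) - psi c s) := by
        rw [← add_assoc, FF_succ]; push_cast; ring
      have h1 := hlip s (s + j + 1) hs (Nat.succ_pos _)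
      have e2 : |(s : ℝ) - ((s + j + 1 : ℕ) : ℝ)| = j + 1 := by
        rw [abs_sub_comm, abs_of_nonneg] <;> push_cast
        · ring
        · linarith [(Nat.cast_nonneg j : (0:ℝ) ≤ j)]
      rw [e2, abs_sub_comm] at h1
      rw [e]
      have h2 := mul_le_mul_of_nonneg_right (abs_add_le
        (FF c (s + j) - FF c s - psi c s * (((s + j : ℕ) : ℝ) - s)) (psi c (s + j + 1) - psi c s))
        hs'.le
      refine h2.trans ?_
      push_cast at ih ⊢
      have := mul_nonneg hC (Nat.cast_nonneg (α := ℝ) j)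
      nlinarith
  · obtain ⟨j, hj⟩ := Nat.exists_eq_add_of_le h
    clear h
    induction j generalizing n with
    | zero => simp at hj; subst hj; simp
    | succ j ih =>
      have h0 := ih (n + 1) (by omega)
      have e : FF c n - FF c s - psi c s * ((n : ℝ) - s) =
          (FF c (n + 1) - FF c s - psi c s * (((n + 1 : ℕ) : ℝ) - s)) + (psi c s - psi c (n + 1)) := by
        rw [FF_succ]; push_cast; ring
      have h1 := hlip s (n + 1) hs (Nat.succ_pos _)
      have hsr : (s : ℝ) = n + (j + 1) := by rw [hj]; push_cast; ring
      have e2 : |(s : ℝ) - ((n + 1 : ℕ) : ℝ)| = j := by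
        rw [hsr]; push_cast
        rw [show (n:ℝ) + (j + 1) - (n + 1) = j by ring]; simp
      rw [e2] at h1
      rw [e]
      have h2 := mul_le_mul_of_nonneg_right (abs_add_le
        (FF c (n + 1) - FF c s - psi c s * (((n + 1 : ℕ) : ℝ) - s)) (psi c s - psi c (n + 1)))
        hs'.le
      refine h2.trans ?_
      have e3 : (((n + 1 : ℕ) : ℝ) - s) ^ 2 = (j:ℝ) ^ 2 := by rw [hsr]; push_cast; ring
      have e4 : ((n : ℝ) - s) ^ 2 = ((j:ℝ) + 1) ^ 2 := by rw [hsr]; ring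
      rw [e3] at h0; rw [e4]
      have := mul_nonneg hC (Nat.cast_nonneg (α := ℝ) j)
      nlinarith

lemma RR_bd {C : ℝ} (hC : 0 ≤ C)
    (hlip : ∀ m n : ℕ, 0 < m → 0 < n → |psi c m - psi c n| * m ≤ C * |(m : ℝ) - n|)
    (Λ : Finset ℤ) (hΛ : Λ.Nonempty) (M : ℕ) :
    ∃ κ : ℝ, ∀ η ∈ S Λ (M + 1), |RR c Λ η - κ| ≤ 2 * Λ.card * C * (1 + WW Λ (M + 1) η) := by
  set N : ℝ := ((M + 1 : ℕ) : ℝ) with hN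
  have hN1 : 1 ≤ N := by rw [hN]; push_cast; linarith [(Nat.cast_nonneg M : (0:ℝ) ≤ M)]
  set K : ℝ := (Λ.card : ℝ) with hK
  have hK0 : 0 < K := by rw [hK]; exact_mod_cast hΛ.card_pos
  set b : ℝ := N / K with hb
  have hb0 : 0 < b := by positivity
  set s := ⌈b⌉₊ with hs
  have hs0 : 0 < s := Nat.ceil_pos.2 hb0
  have hs1 : (1:ℝ) ≤ s := by exact_mod_cast hs0
  have hbs : b ≤ s := Nat.le_ceil b
  have hsb : (s:ℝ) < b + 1 := Nat.ceil_lt_add_one hb0.le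
  refine ⟨K * FF c s + psi c s * (N - K * s), fun η hη => ?_⟩
  have hsum : ∑ y ∈ Λ, (η y : ℝ) = N := by
    rw [hN, ← (mem_S.1 hη).1]; push_cast; rfl
  have e : RR c Λ η - (K * FF c s + psi c s * (N - K * s)) =
      ∑ x ∈ Λ, (FF c (η x) - FF c s - psi c s * ((η x : ℝ) - s)) := by
    rw [Finset.sum_sub_distrib, Finset.sum_sub_distrib, ← Finset.mul_sum, Finset.sum_sub_distrib,
      hsum, Finset.sum_const, Finset.sum_const, nsmul_eq_mul, nsmul_eq_mul, RR, ← hK]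
    ring
  rw [e]
  refine (Finset.abs_sum_le_sum_abs _ _).trans ?_
  have h1 : ∀ x ∈ Λ, |FF c (η x) - FF c s - psi c s * ((η x : ℝ) - s)| ≤
      2 * C * (K * (((η x : ℝ) - b) ^ 2 / N) + 1) := by
    intro x _
    refine (FF_taylor hC hlip hs0 (η x)).trans ?_
    rw [div_le_iff₀ (by linarith)]
    have h2 : ((η x : ℝ) - s) ^ 2 ≤ 2 * ((η x : ℝ) - b) ^ 2 + 2 := by
      nlinarith [sq_nonneg ((η x : ℝ) - b - (b - s))]
    have h3 : K * (((η x : ℝ) - b) ^ 2 / N) = ((η x : ℝ) - b) ^ 2 / b := by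
      rw [hb]; field_simp
    rw [h3]
    have h4 : ((η x : ℝ) - b) ^ 2 ≤ ((η x : ℝ) - b) ^ 2 / b * s := by
      rw [div_mul_eq_mul_div, le_div_iff₀ hb0]
      exact mul_le_mul_of_nonneg_left hbs (sq_nonneg _)
    have h5 : ((η x : ℝ) - s) ^ 2 ≤ 2 * ((((η x : ℝ) - b) ^ 2 / b + 1) * s) := by linarith
    have := mul_le_mul_of_nonneg_left h5 hC
    linarith
  refine (Finset.sum_le_sum h1).trans (le_of_eq ?_)
  rw [← Finset.mul_sum, Finset.sum_add_distrib, ← Finset.mul_sum, ← Finset.sum_div, Finset.sum_const,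
    nsmul_eq_mul, ← hK]
  have : WW Λ (M + 1) η = (∑ x ∈ Λ, ((η x : ℝ) - b) ^ 2) / N := rfl
  rw [this]; ring

lemma theta_pt (hc0 : c 0 = 0) (hc : ∀ n : ℕ, 0 < n → 0 < c n)
    (hLG : ∀ k : ℕ, |c (k + 1) - c k| ≤ a₁) (ha₁ : 0 < a₁) (hδ : 0 < δ₁)
    (hlow : ∀ n : ℕ, δ₁ * n ≤ c n) {C : ℝ} (hC : 0 ≤ C)
    (hlip : ∀ m n : ℕ, 0 < m → 0 < n → |psi c m - psi c n| * m ≤ C * |(m : ℝ) - n|)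
    {Λ : Finset ℤ} {x y : ℤ} (hx : x ∈ Λ) (hy : y ∈ Λ) (hxy : y ≠ x) (M : ℕ) (η : ℤ → ℕ) :
    c (η x) * (Real.exp (psi c (η y + 1) / 2) - Real.exp (psi c (η x) / 2)) ^ 2 ≤
      a₁ / δ₁ * (8 * C ^ 2 * Λ.card) * (1 + WW Λ (M + 1) η) := by
  have hW := WW_nonneg Λ (M + 1) η
  rcases Nat.eq_zero_or_pos (η x) with h0 | h0
  · rw [h0, hc0, zero_mul]; positivity
  set N : ℝ := ((M + 1 : ℕ) : ℝ) with hN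
  have hN1 : 1 ≤ N := by rw [hN]; push_cast; linarith [(Nat.cast_nonneg M : (0:ℝ) ≤ M)]
  set K : ℝ := (Λ.card : ℝ) with hK
  have hK0 : 0 < K := by rw [hK]; exact_mod_cast Finset.card_pos.2 ⟨x, hx⟩
  set b : ℝ := N / K with hb
  have hb0 : 0 < b := by positivity
  have h1 := exp_sub_sq (psi_le hc hδ hlow (Nat.succ_pos (η y))) (psi_le hc hδ hlow h0)
  set e := |psi c (η y + 1) - psi c (η x)| with he
  have he0 : 0 ≤ e := abs_nonneg _
  set p : ℝ := (η x : ℝ) with hp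
  set q : ℝ := ((η y + 1 : ℕ) : ℝ) with hq
  have hp0 : 0 < p := by rw [hp]; exact_mod_cast h0
  have hq0 : 0 < q := by rw [hq]; positivity
  have l1 : e * p ≤ C * |p - q| := by
    rw [he, abs_sub_comm]; exact hlip _ _ h0 (Nat.succ_pos _)
  have l2 : e * q ≤ C * |p - q| := by
    rw [abs_sub_comm p]; exact hlip _ _ (Nat.succ_pos _) h0
  have l1' : e ^ 2 * p ^ 2 ≤ C ^ 2 * (p - q) ^ 2 := by
    have := pow_le_pow_left₀ (by positivity) l1 2
    rwa [mul_pow, mul_pow, sq_abs (p - q)] at this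
  have l2' : e ^ 2 * q ^ 2 ≤ C ^ 2 * (p - q) ^ 2 := by
    have := pow_le_pow_left₀ (by positivity) l2 2
    rwa [mul_pow, mul_pow, sq_abs (p - q)] at this
  -- main bound with the larger of the two
  have mb : ∀ m : ℝ, 0 < m → p ≤ m → q ≤ m → e ^ 2 * m ^ 2 ≤ C ^ 2 * (p - q) ^ 2 →
      p * e ^ 2 * b ≤ 2 * C ^ 2 * ((p - q) ^ 2 + (p - b) ^ 2) := by
    intro m hm hpm hqm hl
    have hC2 := sq_nonneg C
    have i1 : p * e ^ 2 * b ≤ m * e ^ 2 * b := by gcongr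
    refine i1.trans ?_
    rcases le_total b (2 * m) with hbm | hbm
    · have : m * e ^ 2 * b ≤ m * e ^ 2 * (2 * m) := by gcongr
      nlinarith [mul_nonneg hC2 (sq_nonneg (p - b))]
    · have i2 : (p - q) ^ 2 ≤ m ^ 2 := by
        apply sq_le_sq'
        · linarith
        · linarith
      have i3 : e ^ 2 ≤ C ^ 2 := by
        have i4 := mul_le_mul_of_nonneg_left i2 hC2
        have i5 : e ^ 2 * m ^ 2 ≤ C ^ 2 * m ^ 2 := hl.trans i4
        exact le_of_mul_le_mul_right i5 (by positivity)
      have i6 : m * b ≤ 2 * (p - b) ^ 2 := by nlinarith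
      have i7 : m * e ^ 2 * b ≤ C ^ 2 * (m * b) := by
        have := mul_le_mul_of_nonneg_right i3 (by positivity : 0 ≤ m * b)
        linarith
      have i8 := mul_le_mul_of_nonneg_left i6 hC2
      nlinarith [mul_nonneg hC2 (sq_nonneg (p - q))]
  have mb' : p * e ^ 2 * b ≤ 2 * C ^ 2 * ((p - q) ^ 2 + (p - b) ^ 2) := by
    rcases le_total p q with h | h
    · exact mb q hq0 h le_rfl l2'
    · exact mb p hp0 le_rfl h l1'
  have hNW : (p - b) ^ 2 + (q - 1 - b) ^ 2 ≤ N * WW Λ (M + 1) η := by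
    have : N * WW Λ (M + 1) η = ∑ z ∈ Λ, ((η z : ℝ) - b) ^ 2 := by
      have : WW Λ (M + 1) η = (∑ x ∈ Λ, ((η x : ℝ) - b) ^ 2) / N := rfl
      rw [this]; field_simp
    rw [this, ← Finset.add_sum_erase Λ _ hx]
    have h2 := Finset.single_le_sum (f := fun z => ((η z : ℝ) - b) ^ 2) (s := Λ.erase x)
      (fun _ _ => sq_nonneg _) (Finset.mem_erase.2 ⟨hxy, hy⟩)
    have h3 : q - 1 = (η y : ℝ) := by rw [hq]; push_cast; ring
    rw [h3]
    linarith
  have f1 : (p - q) ^ 2 + (p - b) ^ 2 ≤ 4 * (N * (1 + WW Λ (M + 1) η)) := by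
    have g1 : (p - q) ^ 2 ≤ 2 * (p - b) ^ 2 + 2 * (q - b) ^ 2 := by
      have : 2 * (p - b) ^ 2 + 2 * (q - b) ^ 2 - (p - q) ^ 2 = ((p - b) + (q - b)) ^ 2 := by ring
      linarith [sq_nonneg ((p - b) + (q - b))]
    have g2 : (q - b) ^ 2 ≤ 2 * (q - 1 - b) ^ 2 + 2 := by
      have : 2 * (q - 1 - b) ^ 2 + 2 - (q - b) ^ 2 = ((q - 1 - b) - 1) ^ 2 := by ring
      linarith [sq_nonneg ((q - 1 - b) - 1)]
    rw [mul_add]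
    linarith [sq_nonneg (p - b)]
  have f2 : p * e ^ 2 * b ≤ 8 * C ^ 2 * (N * (1 + WW Λ (M + 1) η)) := by
    have := mul_le_mul_of_nonneg_left f1 (by positivity : 0 ≤ 2 * C ^ 2)
    linarith
  have f3 : p * e ^ 2 ≤ 8 * C ^ 2 * K * (1 + WW Λ (M + 1) η) := by
    have : p * e ^ 2 * b = p * e ^ 2 * N / K := by rw [hb]; ring
    rw [this, div_le_iff₀ hK0] at f2
    have f4 : p * e ^ 2 * N ≤ 8 * C ^ 2 * K * (1 + WW Λ (M + 1) η) * N := by linarith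
    exact le_of_mul_le_mul_right f4 (by linarith)
  have hcp : c (η x) ≤ a₁ * p := c_upper hc0 hLG _
  calc c (η x) * (Real.exp (psi c (η y + 1) / 2) - Real.exp (psi c (η x) / 2)) ^ 2
      ≤ (a₁ * p) * (1 / δ₁ * e ^ 2) := mul_le_mul hcp h1 (sq_nonneg _) (by positivity)
    _ = a₁ / δ₁ * (p * e ^ 2) := by ring
    _ ≤ a₁ / δ₁ * (8 * C ^ 2 * K * (1 + WW Λ (M + 1) η)) :=
        mul_le_mul_of_nonneg_left f3 (by positivity)
    _ = _ := by ring

lemma DF_gst (hc0 : c 0 = 0) (hc : ∀ n : ℕ, 0 < n → 0 < c n)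
    (hLG : ∀ k : ℕ, |c (k + 1) - c k| ≤ a₁) (ha₁ : 0 < a₁) (hδ : 0 < δ₁)
    (hlow : ∀ n : ℕ, δ₁ * n ≤ c n) {C : ℝ} (hC : 0 ≤ C)
    (hlip : ∀ m n : ℕ, 0 < m → 0 < n → |psi c m - psi c n| * m ≤ C * |(m : ℝ) - n|)
    (Λ : Finset ℤ) (M : ℕ) (h : (ℤ → ℕ) → ℝ) :
    DF cid Λ M (fun η => h η * Real.exp (RR c Λ η / 2)) ≤ 2 / δ₁ * DF c Λ M h +
      2 * (Λ.card : ℝ) ^ 2 * (a₁ / δ₁ * (8 * C ^ 2 * Λ.card)) *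
        ∑ η ∈ S Λ (M + 1), wt c Λ η * (h η ^ 2 * (1 + WW Λ (M + 1) η)) := by
  set Q := a₁ / δ₁ * (8 * C ^ 2 * Λ.card) with hQ
  set Y := ∑ η ∈ S Λ (M + 1), wt c Λ η * (h η ^ 2 * (1 + WW Λ (M + 1) η)) with hY
  set θ : ℕ → ℝ := fun n => Real.exp (psi c n / 2) with hθ
  have hθsq : ∀ n, θ n ^ 2 = Real.exp (psi c n) := fun n => by
    simp only [hθ]; rw [← Real.exp_nat_mul]; congr 1; push_cast; ring
  have e1 : DF cid Λ M (fun η => h η * Real.exp (RR c Λ η / 2)) = ∑ ξ ∈ S Λ M, wt c Λ ξ *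
      ∑ x ∈ Λ, ∑ y ∈ Λ, (h (ad ξ y) * θ (ξ y + 1) - h (ad ξ x) * θ (ξ x + 1)) ^ 2 := by
    unfold DF
    refine Finset.sum_congr rfl fun ξ _ => ?_
    rw [wt_RR hc, mul_assoc]
    congr 1
    simp only [Finset.mul_sum]
    refine Finset.sum_congr rfl fun x hx => Finset.sum_congr rfl fun y hy => ?_
    rw [RR_ad c hx, RR_ad c hy, add_div, add_div, Real.exp_add, Real.exp_add]
    have : Real.exp (RR c Λ ξ) = Real.exp (RR c Λ ξ / 2) ^ 2 := by
      rw [← Real.exp_nat_mul]; congr 1; push_cast; ring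
    rw [this]; simp only [hθ]; ring
  rw [e1]
  have p1 : ∀ ξ ∈ S Λ M, wt c Λ ξ *
      ∑ x ∈ Λ, ∑ y ∈ Λ, (h (ad ξ y) * θ (ξ y + 1) - h (ad ξ x) * θ (ξ x + 1)) ^ 2 ≤
      2 / δ₁ * (wt c Λ ξ * ∑ x ∈ Λ, ∑ y ∈ Λ, (h (ad ξ y) - h (ad ξ x)) ^ 2) +
      2 * ∑ x ∈ Λ, ∑ y ∈ Λ, wt c Λ ξ * (h (ad ξ x) ^ 2 * (θ (ξ y + 1) - θ (ξ x + 1)) ^ 2) := by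
    intro ξ _
    simp only [Finset.mul_sum]
    rw [← Finset.sum_add_distrib]
    apply Finset.sum_le_sum; intro x _
    rw [← Finset.sum_add_distrib]
    apply Finset.sum_le_sum; intro y _
    have t1 : θ (ξ y + 1) ^ 2 ≤ 1 / δ₁ := by rw [hθsq]; exact psi_le hc hδ hlow (Nat.succ_pos _)
    have t2 := mul_le_mul_of_nonneg_right t1 (sq_nonneg (h (ad ξ y) - h (ad ξ x)))
    have t3 : (h (ad ξ y) * θ (ξ y + 1) - h (ad ξ x) * θ (ξ x + 1)) ^ 2 ≤
        2 / δ₁ * (h (ad ξ y) - h (ad ξ x)) ^ 2 +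
          2 * (h (ad ξ x) ^ 2 * (θ (ξ y + 1) - θ (ξ x + 1)) ^ 2) := by
      have t4 : 2 / δ₁ = 2 * (1 / δ₁) := by ring
      rw [t4]
      nlinarith [sq_nonneg (θ (ξ y + 1) * (h (ad ξ y) - h (ad ξ x)) -
        h (ad ξ x) * (θ (ξ y + 1) - θ (ξ x + 1)))]
    have := mul_le_mul_of_nonneg_left t3 (wt_pos hc Λ ξ).le
    linarith
  refine (Finset.sum_le_sum p1).trans ?_
  rw [Finset.sum_add_distrib, ← Finset.mul_sum, ← Finset.mul_sum]
  have p2 : ∑ ξ ∈ S Λ M, ∑ x ∈ Λ, ∑ y ∈ Λ,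
      wt c Λ ξ * (h (ad ξ x) ^ 2 * (θ (ξ y + 1) - θ (ξ x + 1)) ^ 2) ≤
      ∑ x ∈ Λ, ∑ y ∈ Λ, Q * Y := by
    rw [Finset.sum_comm]
    apply Finset.sum_le_sum; intro x hx
    rw [Finset.sum_comm]
    apply Finset.sum_le_sum; intro y hy
    set F : (ℤ → ℕ) → ℝ := fun η => h η ^ 2 *
      (if y = x then 0 else (θ (η y + 1) - θ (η x)) ^ 2) with hF
    have e3 : ∑ ξ ∈ S Λ M, wt c Λ ξ * (h (ad ξ x) ^ 2 * (θ (ξ y + 1) - θ (ξ x + 1)) ^ 2) =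
        ∑ ξ ∈ S Λ M, wt c Λ ξ * F (ad ξ x) := by
      refine Finset.sum_congr rfl fun ξ _ => ?_
      simp only [hF]
      split_ifs with hyx
      · subst hyx; simp
      · rw [ad_self, ad_ne _ hyx]
    rw [e3, ← ibp hc0 hc hx M F, hY, Finset.mul_sum]
    apply Finset.sum_le_sum; intro η _
    have hW := WW_nonneg Λ (M + 1) η
    have t : c (η x) * (if y = x then 0 else (θ (η y + 1) - θ (η x)) ^ 2) ≤
        Q * (1 + WW Λ (M + 1) η) := by
      split_ifs with hyx
      · rw [mul_zero]; positivity
      · exact theta_pt hc0 hc hLG ha₁ hδ hlow hC hlip hx hy hyx M η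
    have := mul_le_mul_of_nonneg_left t (mul_nonneg (wt_pos hc Λ η).le (sq_nonneg (h η)))
    simp only [hF]
    linarith
  simp only [Finset.sum_const, nsmul_eq_mul] at p2
  have e5 : ∑ i ∈ S Λ M, wt c Λ i * ∑ x ∈ Λ, ∑ y ∈ Λ, (h (ad i y) - h (ad i x)) ^ 2 = DF c Λ M h := rfl
  rw [e5]
  nlinarith

end pt

lemma lsi_K {c : ℕ → ℝ} {a₁ a₂ : ℝ} {k₀ : ℕ} (hc0 : c 0 = 0)
    (hcpos : ∀ n : ℕ, 0 < n → 0 < c n) (hLG : ∀ k : ℕ, |c (k + 1) - c k| ≤ a₁) (hk₀ : 0 < k₀)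
    (ha₂ : 0 < a₂) (hM : ∀ j k : ℕ, j + k₀ ≤ k → a₂ ≤ c k - c j) (K : ℕ) (hK : 0 < K) :
    ∃ C : ℝ, 0 < C ∧ ∀ Λ : Finset ℤ, Λ.card = K → ∀ (M : ℕ) (g : (ℤ → ℕ) → ℝ),
      uent (S Λ (M + 1)) (wt c Λ) (fun η => g η ^ 2) ≤ C * DF c Λ M g := by
  have ha₁ : 0 < a₁ := by
    have h1 := hLG 0
    have h2 := hcpos 1 one_pos
    rw [hc0] at h1; simp at h1
    exact lt_of_lt_of_le (abs_pos.2 h2.ne') h1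
  obtain ⟨B, hB0, hB⟩ := c_diff hLG hk₀ ha₂ hM
  obtain ⟨δ, hδ, hlow⟩ := c_lower hc0 hcpos hB0 hB
  obtain ⟨Cg, hCg, hgap⟩ := gap hc0 hcpos hLG ha₂ hM hδ hlow K hK
  obtain ⟨Cb, hCb, hstep⟩ := stepB hc0 hcpos hLG ha₁ hB0 hB K hK
  have hK' : (0:ℝ) < K := by exact_mod_cast hK
  set C := 2 * a₁ / δ with hC
  have hC0 : 0 < C := by positivity
  have hlip : ∀ m n : ℕ, 0 < m → 0 < n → |psi c m - psi c n| * m ≤ C * |(m : ℝ) - n| :=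
    fun m n hm hn => psi_lip hc0 hcpos hLG ha₁ hδ hlow hm hn
  set E1 : ℝ := 15 * ((K:ℝ) + 3) with hE1
  set E2 : ℝ := 2 * (K : ℝ) ^ 2 * (a₁ / δ * (8 * C ^ 2 * K)) with hE2
  set E3 : ℝ := 2 * K * C with hE3
  have hE10 : 0 < E1 := by positivity
  have hE20 : 0 < E2 := by positivity
  have hE30 : 0 < E3 := by positivity
  -- defective inequality
  set A : ℝ := E1 * (2 / δ + E2 * Cb) + E3 * Cb + E3 * Cb with hA
  have hA0 : 0 < A := by positivity
  have dls : ∀ Λ : Finset ℤ, Λ.card = K → ∀ (M : ℕ) (h : (ℤ → ℕ) → ℝ),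
      uent (S Λ (M + 1)) (wt c Λ) (fun η => h η ^ 2) ≤
        A * (DF c Λ M h + ∑ η ∈ S Λ (M + 1), wt c Λ η * h η ^ 2) := by
    intro Λ hΛ M h
    have hne : Λ.Nonempty := Finset.card_pos.1 (by omega)
    obtain ⟨κ, hκ⟩ := RR_bd hC0.le hlip Λ hne M
    rw [hΛ] at hκ
    have hV : ∑ η ∈ S Λ (M + 1), wt c Λ η * (1 + WW Λ (M + 1) η) ≤
        Cb * ∑ η ∈ S Λ (M + 1), wt c Λ η := by
      have := hstep Λ hΛ M (fun _ => 1)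
      simpa [DF] using this
    have h1 := gst (S Λ (M + 1)) (wt c Λ) (wt cid Λ) (RR c Λ) h (fun η => 1 + WW Λ (M + 1) η)
      (fun η _ => wt_pos cidpos Λ η) (fun η _ => wt_RR hcpos Λ η) (S_nonempty hne _)
      hE30.le hκ hV
    have h2 := lsi_multi Λ hne M (fun η => h η * Real.exp (RR c Λ η / 2))
    have h3 := DF_gst hc0 hcpos hLG ha₁ hδ hlow hC0.le hlip Λ M h
    have h4 := hstep Λ hΛ M h
    rw [hΛ, ← hE2] at h3
    rw [hΛ, ← hE1] at h2
    have hD0 := DF_nonneg hcpos Λ M h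
    set X := ∑ η ∈ S Λ (M + 1), wt c Λ η * h η ^ 2 with hX
    have hX0 : 0 ≤ X := Finset.sum_nonneg fun η _ => mul_nonneg (wt_pos hcpos _ _).le (sq_nonneg _)
    set Y := ∑ η ∈ S Λ (M + 1), wt c Λ η * (h η ^ 2 * (1 + WW Λ (M + 1) η)) with hY
    set D := DF c Λ M h with hD
    have h5 := mul_le_mul_of_nonneg_left h4 hE20.le
    have h6 := mul_le_mul_of_nonneg_left h4 hE30.le
    have h7 := mul_le_mul_of_nonneg_left (h3.trans (add_le_add_right h5 _)) hE10.le
    have h8 : 0 ≤ E1 * (2 / δ) * X := by positivity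
    have h9 : 0 ≤ E3 * Cb * D := by positivity
    have h10 : A * (D + X) = E1 * (2 / δ * D + E2 * (Cb * (D + X))) + E3 * (Cb * (D + X)) +
      E3 * Cb * X + (E1 * (2 / δ) * X + E3 * Cb * D) := by rw [hA]; ring
    rw [h10]
    linarith
  refine ⟨15 * (A * (1 + Cg) + 3 * Cg), by positivity, fun Λ hΛ M g => ?_⟩
  have hne : Λ.Nonempty := Finset.card_pos.1 (by omega)
  obtain ⟨a, ha⟩ := hgap Λ hΛ M g
  have h1 := center (S Λ (M + 1)) (wt c Λ) g (fun η _ => (wt_pos hcpos Λ η).le)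
    (Z_pos hcpos hne _) a
  have h2 := dls Λ hΛ M (fun η => g η - a)
  have e : DF c Λ M (fun η => g η - a) = DF c Λ M g := by
    unfold DF; simp
  rw [e] at h2
  have h3 := mul_le_mul_of_nonneg_left ha hA0.le
  linarith

end ZR

namespace ZR

lemma path_cmp (a : ℤ) (K : ℕ) (v : ℤ → ℝ) :
    ∑ x ∈ Finset.Ico a (a + (K : ℤ)), ∑ y ∈ Finset.Ico a (a + (K : ℤ)), (v y - v x) ^ 2 ≤
      (K : ℝ) ^ 4 * ∑ x ∈ Finset.Ico a (a + (K : ℤ)), ∑ y ∈ Finset.Ico a (a + (K : ℤ)),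
        (if |x - y| = 1 then (v y - v x) ^ 2 else 0) := by
  set Λ := Finset.Ico a (a + (K : ℤ)) with hΛ
  have hcard : Λ.card = K := by simp [hΛ]
  set E := ∑ x ∈ Λ, ∑ y ∈ Λ, (if |x - y| = 1 then (v y - v x) ^ 2 else 0) with hE
  have hnn : ∀ x y : ℤ, 0 ≤ (if |x - y| = 1 then (v y - v x) ^ 2 else 0) := by
    intro x y; split_ifs
    · exact sq_nonneg _
    · exact le_rfl
  have hE0 : 0 ≤ E := Finset.sum_nonneg fun _ _ => Finset.sum_nonneg fun _ _ => hnn _ _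
  have step : ∀ x, x ∈ Λ → x + 1 ∈ Λ → |v (x + 1) - v x| ≤ Real.sqrt E := by
    intro x hx hx1
    apply Real.abs_le_sqrt
    refine le_trans ?_ (Finset.single_le_sum
      (f := fun x => ∑ y ∈ Λ, (if |x - y| = 1 then (v y - v x) ^ 2 else 0))
      (fun _ _ => Finset.sum_nonneg fun _ _ => hnn _ _) hx)
    refine le_trans ?_ (Finset.single_le_sum
      (f := fun y => (if |x - y| = 1 then (v y - v x) ^ 2 else 0)) (fun _ _ => hnn _ _) hx1)
    simp
  have walk : ∀ (n : ℕ) (x : ℤ), x ∈ Λ → x + n ∈ Λ → |v (x + n) - v x| ≤ n * Real.sqrt E := by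
    intro n
    induction n with
    | zero => intro x _ _; simp
    | succ n ih =>
      intro x hx hxn
      have h1 : x + n ∈ Λ := by
        rw [hΛ, Finset.mem_Ico] at *; push_cast at hxn; omega
      have h2 := ih x hx h1
      have h3 : x + ((n + 1 : ℕ) : ℤ) = (x + n) + 1 := by push_cast; ring
      rw [h3] at hxn ⊢
      have h4 := step _ h1 hxn
      have h5 := abs_add_le (v (x + n + 1) - v (x + n)) (v (x + n) - v x)
      rw [sub_add_sub_cancel] at h5
      push_cast
      linarith
  have le : ∀ x ∈ Λ, ∀ y ∈ Λ, x ≤ y → (v y - v x) ^ 2 ≤ (K : ℝ) ^ 2 * E := by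
    intro x hx y hy hxy
    obtain ⟨n, rfl⟩ := Int.le.dest hxy
    have h1 := walk n x hx hy
    have hn : n ≤ K := by
      rw [hΛ, Finset.mem_Ico] at *; omega
    have hn' : (n : ℝ) ≤ K := by exact_mod_cast hn
    have h2 : |v (x + n) - v x| ≤ K * Real.sqrt E :=
      h1.trans (mul_le_mul_of_nonneg_right hn' (Real.sqrt_nonneg _))
    have h3 := pow_le_pow_left₀ (abs_nonneg _) h2 2
    rwa [sq_abs, mul_pow, Real.sq_sqrt hE0] at h3
  have all : ∀ x ∈ Λ, ∀ y ∈ Λ, (v y - v x) ^ 2 ≤ (K : ℝ) ^ 2 * E := by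
    intro x hx y hy
    rcases le_total x y with h | h
    · exact le x hx y hy h
    · have := le y hy x hx h
      linarith [show (v y - v x) ^ 2 = (v x - v y) ^ 2 by ring]
  refine (Finset.sum_le_sum fun x hx => Finset.sum_le_sum fun y hy => all x hx y hy).trans
    (le_of_eq ?_)
  simp only [Finset.sum_const, hcard, nsmul_eq_mul]
  ring

lemma nuW_mem (c : ℕ → ℝ) (Λ : Finset ℤ) (N : ℕ) {η : ℤ → ℕ} (h : η ∈ S Λ N) :
    nuW c Λ N η = wt c Λ η := by
  rw [mem_S] at h
  unfold nuW wt
  rw [Set.indicator_of_mem]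
  exact ⟨fun x hx => by by_contra h0; exact hx (h.2 x h0), h.1⟩

lemma nuW_not_mem (c : ℕ → ℝ) (Λ : Finset ℤ) (N : ℕ) {η : ℤ → ℕ} (h : η ∉ S Λ N) :
    nuW c Λ N η = 0 := by
  unfold nuW
  rw [Set.indicator_of_notMem]
  intro h1
  apply h
  rw [mem_S]
  exact ⟨h1.2, fun x hx => by by_contra h0; exact hx (h1.1 x h0)⟩

lemma wE_eq (c : ℕ → ℝ) (Λ : Finset ℤ) (N : ℕ) (f : (ℤ → ℕ) → ℝ) :
    wE (nuW c Λ N) f = (∑ η ∈ S Λ N, wt c Λ η * f η) / ∑ η ∈ S Λ N, wt c Λ η := by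
  unfold wE
  rw [tsum_eq_sum (s := S Λ N) (fun η hη => by rw [nuW_not_mem c Λ N hη, zero_mul]),
    tsum_eq_sum (s := S Λ N) (fun η hη => nuW_not_mem c Λ N hη)]
  rw [Finset.sum_congr rfl fun η hη => by rw [nuW_mem c Λ N hη],
    Finset.sum_congr rfl fun η hη => nuW_mem c Λ N hη]

lemma wEnt_eq {c : ℕ → ℝ} (Λ : Finset ℤ) (N : ℕ) (f : (ℤ → ℕ) → ℝ) :
    wEnt (nuW c Λ N) f = uent (S Λ N) (wt c Λ) f / ∑ η ∈ S Λ N, wt c Λ η := by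
  unfold wEnt uent
  rw [wE_eq, wE_eq]; ring

lemma move_ad (ξ : ℤ → ℕ) {x y : ℤ} (h : x ≠ y) : move (ad ξ x) x y = ad ξ y := by
  funext z
  simp only [move, ad]
  by_cases h1 : z = x
  · subst h1; simp [h]
  · by_cases h2 : z = y
    · subst h2; simp [h1]
    · simp [h1, h2]

lemma wDir_eq {c : ℕ → ℝ} (hc0 : c 0 = 0) (hc : ∀ n : ℕ, 0 < n → 0 < c n) (Λ : Finset ℤ) (M : ℕ)
    (g : (ℤ → ℕ) → ℝ) :
    wDir c Λ (nuW c Λ (M + 1)) g g = (1 / 2 * ∑ ξ ∈ S Λ M, wt c Λ ξ * ∑ x ∈ Λ, ∑ y ∈ Λ,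
      (if |x - y| = 1 then (g (ad ξ y) - g (ad ξ x)) ^ 2 else 0)) /
        ∑ η ∈ S Λ (M + 1), wt c Λ η := by
  unfold wDir
  rw [wE_eq]
  congr 1
  set F : ℤ → ℤ → (ℤ → ℕ) → ℝ := fun x y η => if |x - y| = 1 then (g (move η x y) - g η) ^ 2 else 0
    with hF
  have h1 : ∑ η ∈ S Λ (M + 1), wt c Λ η * (1 / 2 * ∑ x ∈ Λ, ∑ y ∈ Λ,
      if |x - y| = 1 then c (η x) * ((g (move η x y) - g η) * (g (move η x y) - g η)) else 0) =
      1 / 2 * ∑ x ∈ Λ, ∑ y ∈ Λ, ∑ η ∈ S Λ (M + 1), wt c Λ η * (c (η x) * F x y η) := by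
    have : ∀ η ∈ S Λ (M + 1), wt c Λ η * (1 / 2 * ∑ x ∈ Λ, ∑ y ∈ Λ,
      if |x - y| = 1 then c (η x) * ((g (move η x y) - g η) * (g (move η x y) - g η)) else 0) =
      1 / 2 * ∑ x ∈ Λ, ∑ y ∈ Λ, wt c Λ η * (c (η x) * F x y η) := by
      intro η _
      simp only [Finset.mul_sum]
      refine Finset.sum_congr rfl fun x _ => Finset.sum_congr rfl fun y _ => ?_
      simp only [hF]
      split_ifs <;> ring
    rw [Finset.sum_congr rfl this, ← Finset.mul_sum, Finset.sum_comm]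
    congr 1
    refine Finset.sum_congr rfl fun x _ => ?_
    rw [Finset.sum_comm]
  rw [h1]
  congr 1
  simp only [Finset.mul_sum]
  symm
  rw [Finset.sum_comm]
  refine Finset.sum_congr rfl fun x hx => ?_
  rw [Finset.sum_comm]
  refine Finset.sum_congr rfl fun y _ => ?_
  rw [ibp hc0 hc hx M (F x y)]
  symm
  refine Finset.sum_congr rfl fun ξ _ => ?_
  simp only [hF]
  split_ifs with h
  · have hxy : x ≠ y := by rintro rfl; simp at h
    rw [move_ad ξ hxy]
  · rfl

lemma final {c : ℕ → ℝ} {a₁ a₂ : ℝ} {k₀ : ℕ} (hc0 : c 0 = 0)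
    (hcpos : ∀ n : ℕ, 0 < n → 0 < c n) (hLG : ∀ k : ℕ, |c (k + 1) - c k| ≤ a₁) (hk₀ : 0 < k₀)
    (ha₂ : 0 < a₂) (hM : ∀ j k : ℕ, j + k₀ ≤ k → a₂ ≤ c k - c j) (L : ℕ) :
    ∃ s : ℝ, 0 < s ∧ ∀ (a : ℤ) (K N : ℕ), 1 ≤ K → K ≤ L → 1 ≤ N →
      ∀ f : (ℤ → ℕ) → ℝ, (∀ η, 0 ≤ f η) →
        wEnt (nuW c (Finset.Ico a (a + (K : ℤ))) N) f ≤
          s * wDir c (Finset.Ico a (a + (K : ℤ))) (nuW c (Finset.Ico a (a + (K : ℤ))) N)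
            (fun η => Real.sqrt (f η)) (fun η => Real.sqrt (f η)) := by
  have hex : ∀ K : ℕ, ∃ C : ℝ, 0 < C ∧ (0 < K → ∀ Λ : Finset ℤ, Λ.card = K →
      ∀ (M : ℕ) (g : (ℤ → ℕ) → ℝ),
      uent (S Λ (M + 1)) (wt c Λ) (fun η => g η ^ 2) ≤ C * DF c Λ M g) := by
    intro K
    rcases Nat.eq_zero_or_pos K with h | h
    · exact ⟨1, one_pos, fun h' => absurd h' (by omega)⟩
    · obtain ⟨C, h1, h2⟩ := lsi_K hc0 hcpos hLG hk₀ ha₂ hM K h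
      exact ⟨C, h1, fun _ => h2⟩
  choose C hC0 hC using hex
  refine ⟨1 + ∑ K ∈ Finset.range (L + 1), C K * (2 * (K : ℝ) ^ 4), ?_, ?_⟩
  · have : 0 ≤ ∑ K ∈ Finset.range (L + 1), C K * (2 * (K : ℝ) ^ 4) :=
      Finset.sum_nonneg fun K _ => by have := hC0 K; positivity
    linarith
  intro a K N hK hKL hN f hf
  obtain ⟨M, rfl⟩ : ∃ M, N = M + 1 := ⟨N - 1, by omega⟩
  have hs : C K * (2 * (K : ℝ) ^ 4) ≤ 1 + ∑ K ∈ Finset.range (L + 1), C K * (2 * (K : ℝ) ^ 4) := by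
    have := Finset.single_le_sum (f := fun K : ℕ => C K * (2 * (K : ℝ) ^ 4))
      (s := Finset.range (L + 1)) (fun K _ => by have := hC0 K; positivity)
      (Finset.mem_range.2 (by omega : K < L + 1))
    linarith
  set s := 1 + ∑ K ∈ Finset.range (L + 1), C K * (2 * (K : ℝ) ^ 4)
  have hpath : ∀ ξ : ℤ → ℕ, _ := fun ξ => path_cmp a K (fun x => Real.sqrt (f (ad ξ x)))
  have hcard : (Finset.Ico a (a + (K : ℤ))).card = K := by simp
  set Λ := Finset.Ico a (a + (K : ℤ))
  have hne : Λ.Nonempty := Finset.card_pos.1 (by omega)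
  have hZ := Z_pos hcpos hne (M + 1)
  rw [wEnt_eq, wDir_eq hc0 hcpos, ← mul_div_assoc]
  apply div_le_div_of_nonneg_right _ hZ.le
  have h1 := hC K (by omega) Λ hcard M (fun η => Real.sqrt (f η))
  have e : (fun η => Real.sqrt (f η) ^ 2) = f := funext fun η => Real.sq_sqrt (hf η)
  rw [e] at h1
  refine h1.trans ?_
  set T := ∑ ξ ∈ S Λ M, wt c Λ ξ * ∑ x ∈ Λ, ∑ y ∈ Λ,
      (if |x - y| = 1 then (Real.sqrt (f (ad ξ y)) - Real.sqrt (f (ad ξ x))) ^ 2 else 0) with hT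
  have hT0 : 0 ≤ T := by
    apply Finset.sum_nonneg; intro ξ _
    apply mul_nonneg (wt_pos hcpos Λ ξ).le
    apply Finset.sum_nonneg; intro x _
    apply Finset.sum_nonneg; intro y _
    split_ifs
    · exact sq_nonneg _
    · exact le_rfl
  have h2 : DF c Λ M (fun η => Real.sqrt (f η)) ≤ (K : ℝ) ^ 4 * T := by
    unfold DF
    rw [hT, Finset.mul_sum]
    apply Finset.sum_le_sum; intro ξ _
    have := mul_le_mul_of_nonneg_left (hpath ξ) (wt_pos hcpos Λ ξ).le
    linarith
  have h3 := mul_le_mul_of_nonneg_left h2 (hC0 K).le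
  have h4 := mul_le_mul_of_nonneg_right hs (by linarith : 0 ≤ 1 / 2 * T)
  linarith

end ZR

/-- (3.18): for each fixed `L`, a logarithmic Sobolev inequality holds on all segments of
length at most `L`, with a constant independent of the number of particles. -/
theorem statement10
    (c : ℕ → ℝ) (a₁ a₂ : ℝ) (k₀ : ℕ)
    (hc0 : c 0 = 0) (hcpos : ∀ n : ℕ, 0 < n → 0 < c n)
    (hLG : ∀ k : ℕ, |c (k + 1) - c k| ≤ a₁)
    (hk₀ : 0 < k₀) (ha₂ : 0 < a₂)
    (hM : ∀ j k : ℕ, j + k₀ ≤ k → a₂ ≤ c k - c j)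
    (L : ℕ) (hL : 2 ≤ L) :
    ∃ s : ℝ, 0 < s ∧ ∀ (a : ℤ) (K N : ℕ), 1 ≤ K → K ≤ L → 1 ≤ N →
      ∀ f : (ℤ → ℕ) → ℝ, (∀ η, 0 ≤ f η) →
        wEnt (nuW c (Finset.Ico a (a + (K : ℤ))) N) f ≤
          s * wDir c (Finset.Ico a (a + (K : ℤ))) (nuW c (Finset.Ico a (a + (K : ℤ))) N)
            (fun η => Real.sqrt (f η)) (fun η => Real.sqrt (f η)) := by
  exact ZR.final hc0 hcpos hLG hk₀ ha₂ hM L
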